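/- Let p, q ∈ C(n). Then in the descent algebra ΣD_n one has B_p B_q = Σ_{t ∈ Z(p,q)} B̃_{r(t)}, where, writing r(t) = [r_1(t), r_2(t), …] for the reading word of the filled template t, the element B̃_{r(t)} is determined as follows: (1) if q ∈ C_1, then B̃_{r(t)} = B_{r(t)}; (2) if q ∈ C_n, then B̃_{r(t)} = B_{r(t)}; (3) if q ∈ C_n', then B̃_{r(t)} = B_{r(t)} if r_1(t) = 1, and B̃_{r(t)} = B_{r(t)'} otherwise; (4) if q ∈ C_{<n}, then: (a) if r_1(t) ≥ 2 and either (p ∈ C_1 ∪ C_n and 𝓨(t) is odd) or (p ∈ C_n' and 𝓨(t) is even), then B̃_{r(t)} = B_{r(t)'}; (b) if p ∈ C_{<n} and z_{00} = 0, then B̃_{r(t)} = 2 B_{r(t)} if r_1(t) = 1, and B̃_{r(t)} = B_{r(t)} + B_{r(t)'} otherwise; (c) in all remaining cases B̃_{r(t)} = B_{r(t)}. (Here, for a composition c of n with first component ≥ 2, B_c denotes the basis element indexed by the copy of c in C_n and B_{c'} the one indexed by its copy in C_n'.) -/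

import Mathlib

open scoped Classical

namespace DescentD

/-- The domain on which the Coxeter group `D_n` acts: the pair `(k, b)` encodes the
integer `k + 1` if `b = true` and `-(k + 1)` if `b = false`.  (We use `Fin (n + 1)`
so that the type is always nonempty; only the points with `k < n` are moved.) -/
abbrev Dom (n : ℕ) := Fin (n + 1) × Bool

/-- The point of `Dom n` encoding the nonzero integer `a` (for `1 ≤ |a| ≤ n`). -/
def pt (n : ℕ) (a : ℤ) : Dom n :=
  (⟨(a.natAbs - 1) % (n + 1), Nat.mod_lt _ n.succ_pos⟩, decide (0 < a))

/-- The transposition exchanging the points encoding `a` and `b`. -/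
def swapD (n : ℕ) (a b : ℤ) : Equiv.Perm (Dom n) := Equiv.swap (pt n a) (pt n b)

/-- The Coxeter generators of `D_n`:  index `0` is `s_{1'} = (-2,1)(-1,2)` and index
`i` with `1 ≤ i ≤ n - 1` is `s_i = (-i-1,-i)(i,i+1)`. -/
def gen (n : ℕ) (i : ℕ) : Equiv.Perm (Dom n) :=
  if i = 0 then swapD n (-2) 1 * swapD n (-1) 2
  else swapD n (-(i : ℤ) - 1) (-(i : ℤ)) * swapD n (i : ℤ) ((i : ℤ) + 1)

/-- The Coxeter group `D_n`, as the subgroup generated by `s_{1'}, s_1, …, s_{n-1}`. -/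
def Dgroup (n : ℕ) : Subgroup (Equiv.Perm (Dom n)) :=
  Subgroup.closure (gen n '' Set.Iio n)

/-- Coxeter length of `w` with respect to the generators of `D_n`. -/
noncomputable def len (n : ℕ) (w : Equiv.Perm (Dom n)) : ℕ :=
  sInf {k | ∃ l : List ℕ, (∀ i ∈ l, i < n) ∧ l.length = k ∧ (l.map (gen n)).prod = w}

/-- The parabolic subgroup `W_J` for a set `J` of generator indices. -/
def WJ (n : ℕ) (J : Set ℕ) : Subgroup (Equiv.Perm (Dom n)) :=
  Subgroup.closure (gen n '' J)

/-- The set `X_J` of minimal length left coset representatives of `W_J` in `D_n`. -/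
def X (n : ℕ) (J : Set ℕ) : Set (Equiv.Perm (Dom n)) :=
  {w | w ∈ Dgroup n ∧ ∀ u ∈ WJ n J, len n w ≤ len n (w * u)}

/-- `𝒳_J`: the sum, in the group algebra `ℚ[D_n]`, of the minimal length left coset
representatives of `W_J`. -/
noncomputable def XX (n : ℕ) (J : Set ℕ) : MonoidAlgebra ℚ (Equiv.Perm (Dom n)) :=
  ∑ w : Equiv.Perm (Dom n),
    if w ∈ X n J then MonoidAlgebra.of ℚ (Equiv.Perm (Dom n)) w else 0

/-- `q` is a composition of `m`: a list of positive integers with sum `m`. -/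
def IsComposition (q : List ℕ) (m : ℕ) : Prop := (∀ x ∈ q, 0 < x) ∧ q.sum = m

/-- The four families making up `C(n)`:  `C_{<n}`, `C_1`, `C_n` and `C_n'`. -/
inductive Kind | lt | one | reg | prime
deriving DecidableEq

/-- Membership of a composition in each of the four families of `C(n)`. -/
def memC (n : ℕ) : Kind → List ℕ → Prop
  | .lt, q => (∀ x ∈ q, 0 < x) ∧ q.sum + 2 ≤ n
  | .one, q => (∀ x ∈ q, 0 < x) ∧ q.sum = n ∧ q.headD 0 = 1
  | .reg, q => (∀ x ∈ q, 0 < x) ∧ q.sum = n ∧ 2 ≤ q.headD 0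
  | .prime, q => (∀ x ∈ q, 0 < x) ∧ q.sum = n ∧ 2 ≤ q.headD 0

/-- The sum of the first `j` components of `q`. -/
def psum (q : List ℕ) (j : ℕ) : ℕ := (q.take j).sum

/-- The subset of generator indices (`0` standing for `s_{1'}`, `i ≥ 1` for `s_i`)
corresponding to `q ∈ C(n)`. -/
def JofC (n : ℕ) : Kind → List ℕ → Set ℕ
  | .lt, q => {s | ∃ j < q.length, s = (n - q.sum) + psum q j}
  | .one, q => {0} ∪ {s | ∃ j, 1 ≤ j ∧ j < q.length ∧ s = psum q j}
  | .reg, q => {0} ∪ {s | ∃ j, 1 ≤ j ∧ j < q.length ∧ s = psum q j}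
  | .prime, q => {1} ∪ {s | ∃ j, 1 ≤ j ∧ j < q.length ∧ s = psum q j}

/-- The basis element `B_q = 𝒳_{J^c}` of `ΣD_n`, for `q` in the family `k` of `C(n)`. -/
noncomputable def B (n : ℕ) (k : Kind) (q : List ℕ) :
    MonoidAlgebra ℚ (Equiv.Perm (Dom n)) :=
  XX n (Set.Iio n \ JofC n k q)


/-- A filled template: rows `z_0, y_1, z_1, …, y_u, z_u` and columns `0, 1, …, v`,
with all entries non-negative integers.  The entries `z i j` are meaningful for
`i ≤ u`, `j ≤ v`, the entries `y i j` for `1 ≤ i ≤ u`, `1 ≤ j ≤ v`; all other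
values of the functions are required to be `0`. -/
structure FT where
  u : ℕ
  v : ℕ
  z : ℕ → ℕ → ℕ
  y : ℕ → ℕ → ℕ
  hz : ∀ i j, u < i ∨ v < j → z i j = 0
  hy : ∀ i j, i = 0 ∨ j = 0 ∨ u < i ∨ v < j → y i j = 0

/-- The border-sum `𝓑(t) = z_{00} + Σ_{i=1}^u z_{i0} + Σ_{j=1}^v z_{0j}`. -/
def borderSum (t : FT) : ℕ :=
  t.z 0 0 + ∑ i ∈ Finset.Icc 1 t.u, t.z i 0 + ∑ j ∈ Finset.Icc 1 t.v, t.z 0 j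

/-- The y-sum `𝓨(t) = Σ_{i,j} y_{ij}`. -/
def ySum (t : FT) : ℕ := ∑ i ∈ Finset.Icc 1 t.u, ∑ j ∈ Finset.Icc 1 t.v, t.y i j

/-- The reading of row `i ≥ 1` of a template: `y_{iv}, …, y_{i1}, z_{i0}, z_{i1}, …, z_{iv}`. -/
def rowWord (t : FT) (i : ℕ) : List ℕ :=
  ((List.range' 1 t.v).reverse.map fun j => t.y i j) ++ [t.z i 0]
    ++ ((List.range' 1 t.v).map fun j => t.z i j)

/-- The reading word `r(t)`: the sequence
`z_{01}, …, z_{0v}, y_{1v}, …, y_{11}, z_{10}, z_{11}, …, z_{1v}, …, z_{u0}, …, z_{uv}`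
with zero entries omitted, prefixed by an extra entry `1` when `z_{00} = 1`. -/
def readWord (t : FT) : List ℕ :=
  (if t.z 0 0 = 1 then [1] else []) ++
    ((((List.range' 1 t.v).map fun j => t.z 0 j)
        ++ (List.range' 1 t.u).flatMap (rowWord t)).filter fun x => x != 0)

/-- The condition on the pair of families of `p` and `q` under which, in condition (5)
for `Z(p,q)`, the y-sum is required to be odd:
`(p ∈ C_1 ∪ C_n and q ∈ C_n')` or `(p ∈ C_n' and q ∈ C_1 ∪ C_n)`. -/
def oddCase (kp kq : Kind) : Prop :=
  ((kp = .one ∨ kp = .reg) ∧ kq = .prime) ∨ (kp = .prime ∧ (kq = .one ∨ kq = .reg))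

/-- The set `Z(p, q)` of filled templates, for `p ⊨ l ≤ n` in the family `kp` and
`q ⊨ m ≤ n` in the family `kq` of `C(n)`. -/
def Z (n : ℕ) (kp : Kind) (p : List ℕ) (kq : Kind) (q : List ℕ) : Set FT :=
  {t | t.v = p.length ∧ t.u = q.length ∧
    (∀ j ∈ Finset.Icc 1 t.v,
      t.z 0 j + ∑ i ∈ Finset.Icc 1 t.u, (t.y i j + t.z i j) = p.getD (j - 1) 0) ∧
    (∑ i ∈ Finset.Icc 0 t.u, t.z i 0 = n - p.sum) ∧
    (∀ i ∈ Finset.Icc 1 t.u,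
      t.z i 0 + ∑ j ∈ Finset.Icc 1 t.v, (t.y i j + t.z i j) = q.getD (i - 1) 0) ∧
    (∑ j ∈ Finset.Icc 0 t.v, t.z 0 j = n - q.sum) ∧
    (borderSum t = 0 → (Odd (ySum t) ↔ oddCase kp kq))}


/-- The family of `C(n)` containing the (unprimed) index `r`:  `C_{<n}` if the sum of
`r` is less than `n`, and otherwise `C_1` or `C_n` according to the first component. -/
def plainKind (n : ℕ) (r : List ℕ) : Kind :=
  if r.sum < n then .lt else if r.headD 0 = 1 then .one else .reg

/-- The summand `B̃_{r(t)}` appearing in the multiplication rule for `B_p B_q`,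
where `p` lies in the family `kp` and `q` in the family `kq` of `C(n)`. -/
noncomputable def Btilde (n : ℕ) (kp kq : Kind) (t : FT) :
    MonoidAlgebra ℚ (Equiv.Perm (Dom n)) :=
  let r := readWord t
  match kq with
  | .one => B n (plainKind n r) r
  | .reg => B n (plainKind n r) r
  | .prime => if r.headD 0 = 1 then B n (plainKind n r) r else B n .prime r
  | .lt =>
      if 2 ≤ r.headD 0 ∧
          (((kp = .one ∨ kp = .reg) ∧ Odd (ySum t)) ∨ (kp = .prime ∧ Even (ySum t))) then
        B n .prime r
      else if kp = .lt ∧ t.z 0 0 = 0 then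
        (if r.headD 0 = 1 then (2 : ℚ) • B n (plainKind n r) r
         else B n (plainKind n r) r + B n .prime r)
      else B n (plainKind n r) r

/-! ### Standardization of letter functions -/

/-- `w` is increasing on every fibre of `f`. -/
def IncrOnFibers {N : ℕ} {α : Type*} (f : Fin N → α) (w : Equiv.Perm (Fin N)) : Prop :=
  ∀ x y, x < y → f x = f y → w x < w y

theorem IncrOnFibers.eq_sort {N : ℕ} {α : Type*} [LinearOrder α] {f : Fin N → α}
    {w : Equiv.Perm (Fin N)} (hw : IncrOnFibers f w) (hf : Monotone f) :
    w = Tuple.sort (f ∘ ⇑w⁻¹) := by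
  rw [Tuple.eq_sort_iff]
  refine ⟨?_, fun i j hij h => hw i j hij (by simpa using h)⟩
  have : (f ∘ ⇑w⁻¹) ∘ ⇑w = f := by ext x; simp
  rwa [this]

/-- The number of positions carrying the letter `c`. -/
noncomputable def fiberCard {N : ℕ} {α : Type*} (f : Fin N → α) (c : α) : ℕ :=
  (Finset.univ.filter fun x => f x = c).card

theorem fiberCard_comp_perm {N : ℕ} {α : Type*} (f : Fin N → α) (w : Equiv.Perm (Fin N)) (c : α) :
    fiberCard (f ∘ w) c = fiberCard f c := by
  unfold fiberCard
  refine Finset.card_bij (fun x _ => w x) ?_ ?_ ?_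
  · intro x hx; simpa using hx
  · intro x _ y _ h; exact w.injective h
  · intro x hx; exact ⟨w⁻¹ x, by simpa using hx, by simp⟩

theorem exists_perm_of_fiberCard_eq {N : ℕ} {α : Type*} {f g : Fin N → α}
    (h : ∀ c, fiberCard f c = fiberCard g c) : ∃ w : Equiv.Perm (Fin N), g ∘ w = f := by
  have e : ∀ c, Nonempty ({a // f a = c} ≃ {b // g b = c}) := by
    intro c
    refine ⟨Fintype.equivOfCardEq ?_⟩
    rw [Fintype.card_subtype, Fintype.card_subtype]
    exact h c
  exact ⟨Equiv.ofFiberEquiv fun c => (e c).some, funext fun a => Equiv.ofFiberEquiv_map _ a⟩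

theorem eq_of_monotone_of_fiberCard_eq {N : ℕ} {α : Type*} [PartialOrder α] {f g : Fin N → α}
    (hf : Monotone f) (hg : Monotone g) (h : ∀ c, fiberCard f c = fiberCard g c) : f = g := by
  obtain ⟨w, hw⟩ := exists_perm_of_fiberCard_eq h
  have := Tuple.unique_monotone (f := g) (σ := w) (τ := 1) (by rwa [hw]) (by simpa using hg)
  simpa [hw] using this

/-! ### Signed permutations as permutations of `Fin (n + n)` commuting with reversal -/

/-- The positive half of `Fin (n + n)`. -/
def pos {n : ℕ} (x : Fin n) : Fin (n + n) := ⟨n + x, by omega⟩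

@[simp] theorem pos_val {n : ℕ} (x : Fin n) : (pos x : ℕ) = n + x := rfl

theorem pos_le_pos {n : ℕ} {x y : Fin n} : pos x ≤ pos y ↔ x ≤ y := by
  rw [Fin.le_def, Fin.le_def]; simp

theorem pos_lt_pos {n : ℕ} {x y : Fin n} : pos x < pos y ↔ x < y := by
  rw [Fin.lt_def, Fin.lt_def]; simp

theorem rev_pos_lt_pos {n : ℕ} (x y : Fin n) : (pos x).rev < pos y := by
  rw [Fin.lt_def]; simp [Fin.val_rev]; omega

theorem eq_pos_or_eq_rev_pos {n : ℕ} (x : Fin (n + n)) :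
    (∃ y : Fin n, x = pos y) ∨ ∃ y : Fin n, x = (pos y).rev := by
  by_cases h : n ≤ x
  · exact Or.inl ⟨⟨x - n, by omega⟩, by ext; simp; omega⟩
  · exact Or.inr ⟨⟨n - 1 - x, by omega⟩, by ext; simp [Fin.val_rev]; omega⟩

/-- The odd extension of a function defined on the positive half. -/
def oddExt {n : ℕ} (φ : Fin n → ℤ) (x : Fin (n + n)) : ℤ :=
  if h : n ≤ x then φ ⟨x - n, by omega⟩ else -φ ⟨n - 1 - x, by omega⟩

@[simp] theorem oddExt_pos {n : ℕ} (φ : Fin n → ℤ) (x : Fin n) : oddExt φ (pos x) = φ x := by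
  simp [oddExt]

@[simp] theorem oddExt_rev_pos {n : ℕ} (φ : Fin n → ℤ) (x : Fin n) :
    oddExt φ (pos x).rev = -φ x := by
  have h : ¬ n ≤ ((pos x).rev : ℕ) := by simp [Fin.val_rev]; omega
  rw [oddExt, dif_neg h]
  congr 2
  ext; simp [Fin.val_rev]; omega

theorem oddExt_rev {n : ℕ} (φ : Fin n → ℤ) (x : Fin (n + n)) :
    oddExt φ x.rev = -oddExt φ x := by
  obtain ⟨y, rfl⟩ | ⟨y, rfl⟩ := eq_pos_or_eq_rev_pos x <;> simp

theorem eq_of_odd {n : ℕ} {F G : Fin (n + n) → ℤ} (hF : ∀ x, F x.rev = -F x)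
    (hG : ∀ x, G x.rev = -G x) (h : ∀ x, F (pos x) = G (pos x)) : F = G := by
  ext x
  obtain ⟨y, rfl⟩ | ⟨y, rfl⟩ := eq_pos_or_eq_rev_pos x
  · exact h y
  · rw [hF, hG, h]

theorem oddExt_monotone {n : ℕ} {φ : Fin n → ℤ} (hφ : Monotone φ) (h0 : ∀ x, 0 ≤ φ x) :
    Monotone (oddExt φ) := by
  intro x y h
  obtain ⟨x, rfl⟩ | ⟨x, rfl⟩ := eq_pos_or_eq_rev_pos x <;>
    obtain ⟨y, rfl⟩ | ⟨y, rfl⟩ := eq_pos_or_eq_rev_pos y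
  · simpa using hφ (pos_le_pos.1 h)
  · exact absurd h (rev_pos_lt_pos y x).not_ge
  · simpa using (neg_nonpos.2 (h0 x)).trans (h0 y)
  · simpa using hφ (pos_le_pos.1 (Fin.rev_le_rev.1 h))

theorem sum_univ_pos {n : ℕ} {M : Type*} [AddCommMonoid M] (f : Fin (n + n) → M) :
    ∑ x, f x = ∑ x : Fin n, f (pos x) + ∑ x : Fin n, f (pos x).rev := by
  rw [Fin.sum_univ_add, add_comm]
  congr 1
  rw [← Equiv.sum_comp Fin.revPerm]
  refine Finset.sum_congr rfl fun x _ => congrArg f ?_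
  ext; simp [Fin.val_rev]; omega

theorem fiberCard_odd {n : ℕ} {F : Fin (n + n) → ℤ} (hF : ∀ x, F x.rev = -F x) (c : ℤ) :
    fiberCard F c = fiberCard (fun x => F (pos x)) c + fiberCard (fun x => F (pos x)) (-c) := by
  simp only [fiberCard, Finset.card_filter]
  rw [sum_univ_pos]
  simp only [hF, neg_eq_iff_eq_neg]
  congr!

/-- Signed permutations: permutations of `Fin (n + n)` commuting with order reversal. -/
def signedPerms (n : ℕ) : Subgroup (Equiv.Perm (Fin (n + n))) where
  carrier := {w | ∀ x, w x.rev = (w x).rev}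
  one_mem' := fun x => rfl
  mul_mem' := by
    intro a b ha hb x
    simp only [Set.mem_ofPred_eq] at ha hb
    simp [ha, hb]
  inv_mem' := by
    intro a ha x
    simp only [Set.mem_ofPred_eq] at ha
    apply a.injective
    simp [ha]

theorem sort_mem_signedPerms {n : ℕ} {F : Fin (n + n) → ℤ} (hF : ∀ x, F x.rev = -F x) :
    Tuple.sort F ∈ signedPerms n := by
  set w := Tuple.sort F with hw
  obtain ⟨hm, ht⟩ := Tuple.eq_sort_iff.1 hw
  have : (Fin.revPerm.trans w).trans Fin.revPerm = w := by
    rw [hw, Tuple.eq_sort_iff]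
    constructor
    · intro i j hij
      have := hm (Fin.rev_le_rev.2 hij)
      simpa [hF] using this
    · intro i j hij h
      have := ht j.rev i.rev (Fin.rev_lt_rev.2 hij)
      simp [hF] at h
      simpa using this h.symm
  intro x
  have h := congrArg (fun v => v x.rev) this
  simpa using h.symm

/-! ### The block function of a composition -/

theorem psum_succ (q : List ℕ) (j : ℕ) : psum q (j + 1) = psum q j + q.getD j 0 := by
  unfold psum
  by_cases h : j < q.length
  · rw [List.take_add_one, List.sum_append]; simp [h]
  · rw [List.take_of_length_le (by omega), List.take_of_length_le (by omega)]
    simp [List.getElem?_eq_none (not_lt.1 h)]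

theorem psum_mono (q : List ℕ) : Monotone (psum q) :=
  monotone_nat_of_le_succ fun j => by rw [psum_succ]; omega

theorem psum_of_length_le {q : List ℕ} {j : ℕ} (h : q.length ≤ j) : psum q j = q.sum := by
  rw [psum, List.take_of_length_le h]

@[simp] theorem psum_zero (q : List ℕ) : psum q 0 = 0 := rfl

/-- The positions at which a new block of `q` starts; block `0` has `n - q.sum` elements. -/
def breaks (n : ℕ) (q : List ℕ) : Set ℕ := {s | ∃ j < q.length, s = n - q.sum + psum q j}

/-- The index of the block of `q` containing the position `x`. -/
noncomputable def level (n : ℕ) (q : List ℕ) (x : ℕ) : ℕ :=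
  ((Finset.range q.length).filter fun j => n - q.sum + psum q j ≤ x).card

theorem level_mono (n : ℕ) (q : List ℕ) : Monotone (level n q) := by
  intro x y h
  refine Finset.card_le_card fun j => ?_
  simp only [Finset.mem_filter]
  exact fun hj => ⟨hj.1, hj.2.trans h⟩

theorem level_le (n : ℕ) (q : List ℕ) (x : ℕ) : level n q x ≤ q.length :=
  (Finset.card_filter_le _ _).trans (by simp)

theorem lt_level_iff {n : ℕ} {q : List ℕ} (hq : q.sum ≤ n) {x j : ℕ} (hx : x < n) :
    j < level n q x ↔ n - q.sum + psum q j ≤ x := by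
  constructor
  · intro h
    by_contra hj
    have : level n q x ≤ (Finset.range j).card := by
      refine Finset.card_le_card fun k => ?_
      simp only [Finset.mem_filter, Finset.mem_range]
      intro hk
      by_contra hkj
      have := psum_mono q (not_lt.1 hkj)
      omega
    simp at this
    omega
  · intro h
    have hj : j < q.length := by
      by_contra hj
      rw [psum_of_length_le (not_lt.1 hj)] at h
      omega
    have : (Finset.range (j + 1)).card ≤ level n q x := by
      refine Finset.card_le_card fun k => ?_
      simp only [Finset.mem_filter, Finset.mem_range]
      intro hk
      have := psum_mono q (Nat.lt_succ_iff.1 hk)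
      omega
    simpa using this

theorem level_succ_eq_iff {n : ℕ} {q : List ℕ} {x : ℕ} :
    level n q x = level n q (x + 1) ↔ x + 1 ∉ breaks n q := by
  have hsub : ((Finset.range q.length).filter fun j => n - q.sum + psum q j ≤ x) ⊆
      (Finset.range q.length).filter fun j => n - q.sum + psum q j ≤ x + 1 := by
    intro j
    simp only [Finset.mem_filter]
    exact fun hj => ⟨hj.1, by omega⟩
  constructor
  · rintro h ⟨j, hj, hjx⟩
    have := Finset.eq_of_subset_of_card_le hsub h.ge
    have hm := Finset.ext_iff.1 this j
    simp only [Finset.mem_filter, Finset.mem_range, hj, true_and] at hm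
    omega
  · intro h
    refine le_antisymm (level_mono n q (by omega)) (Finset.card_le_card fun j => ?_)
    simp only [Finset.mem_filter, Finset.mem_range]
    rintro ⟨hj, hjx⟩
    refine ⟨hj, ?_⟩
    by_contra hlt
    exact h ⟨j, hj, by omega⟩

theorem level_zero_eq_iff {n : ℕ} {q : List ℕ} : level n q 0 = 0 ↔ 0 ∉ breaks n q := by
  rw [level, Finset.card_eq_zero, Finset.filter_eq_empty_iff]
  simp only [Finset.mem_range, breaks, Set.mem_ofPred_eq, not_exists, not_and]
  exact forall₂_congr fun j _ => by omega

/-- The size of the `k`-th block of `q`, where block `0` has `n - q.sum` elements. -/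
def blockSize (n : ℕ) (q : List ℕ) (k : ℕ) : ℕ := if k = 0 then n - q.sum else q.getD (k - 1) 0

theorem card_fin_filter_Ico {n a b : ℕ} (hb : b ≤ n) :
    ((Finset.univ : Finset (Fin n)).filter fun x : Fin n => a ≤ (x : ℕ) ∧ (x : ℕ) < b).card = b - a := by
  rw [← Nat.card_Ico, ← Finset.card_map Fin.valEmbedding]
  congr 1
  ext x
  simp only [Finset.mem_map, Finset.mem_filter, Finset.mem_univ, true_and, Fin.valEmbedding_apply,
    Finset.mem_Ico]
  constructor
  · rintro ⟨y, hy, rfl⟩; exact hy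
  · intro h; exact ⟨⟨x, by omega⟩, h, rfl⟩

theorem fiberCard_level {n : ℕ} {q : List ℕ} (hq : q.sum ≤ n) (k : ℕ) :
    fiberCard (fun x : Fin n => level n q x) k = blockSize n q k := by
  have hle : ∀ j, n - q.sum + psum q j ≤ n := fun j => by
    have := psum_mono q (le_max_left j q.length)
    rw [psum_of_length_le (le_max_right j q.length)] at this
    omega
  unfold fiberCard blockSize
  rcases k with _ | j
  · have h : ∀ x : Fin n, level n q x = 0 ↔ 0 ≤ (x : ℕ) ∧ (x : ℕ) < n - q.sum := by
      intro x
      have := lt_level_iff (j := 0) hq x.2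
      simp at this
      omega
    simp only [h]
    rw [card_fin_filter_Ico (by omega)]
    simp
  · have h : ∀ x : Fin n, level n q x = j + 1 ↔
        n - q.sum + psum q j ≤ (x : ℕ) ∧ (x : ℕ) < n - q.sum + psum q (j + 1) := by
      intro x
      have h1 := lt_level_iff (j := j) hq x.2
      have h2 := lt_level_iff (j := j + 1) hq x.2
      omega
    simp only [h]
    rw [card_fin_filter_Ico (hle _), psum_succ]
    simp
    omega

/-- The odd function on `Fin (n + n)` whose fibres are the blocks of `q` and their negatives. -/
noncomputable def blockFn (n : ℕ) (q : List ℕ) : Fin (n + n) → ℤ :=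
  oddExt fun x : Fin n => (level n q x : ℤ)

@[simp] theorem blockFn_pos {n : ℕ} (q : List ℕ) (x : Fin n) :
    blockFn n q (pos x) = level n q x := by simp [blockFn]

theorem blockFn_rev {n : ℕ} (q : List ℕ) (x : Fin (n + n)) :
    blockFn n q x.rev = -blockFn n q x := oddExt_rev _ x

theorem blockFn_monotone (n : ℕ) (q : List ℕ) : Monotone (blockFn n q) :=
  oddExt_monotone (fun x y h => by exact_mod_cast level_mono n q h) fun x => by positivity

/-! ### Templates as monotone letter functions -/

/-- The non-border letters of a template, in reading order: the pair `(i, j)` stands for the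
entry `z_{ij}` if `0 ≤ j` and for the entry `y_{i,-j}` if `j < 0`. -/
def letters (u v : ℕ) : List (ℕ ×ₗ ℤ) :=
  ((List.range' 1 v).map fun j : ℕ => toLex (0, (j : ℤ))) ++
    (List.range' 1 u).flatMap fun i : ℕ =>
      ((List.range' 1 v).reverse.map fun j : ℕ => toLex (i, -(j : ℤ))) ++ [toLex (i, 0)] ++
        (List.range' 1 v).map fun j : ℕ => toLex (i, (j : ℤ))

/-- The entry of a template corresponding to a letter. -/
def letterCount (t : FT) (c : ℕ ×ₗ ℤ) : ℕ :=
  if 0 ≤ (ofLex c).2 then t.z (ofLex c).1 (ofLex c).2.toNat else t.y (ofLex c).1 (-(ofLex c).2).toNat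

@[simp] theorem letterCount_natCast (t : FT) (i j : ℕ) :
    letterCount t (toLex (i, (j : ℤ))) = t.z i j := by simp [letterCount]

@[simp] theorem letterCount_zero (t : FT) (i : ℕ) :
    letterCount t (toLex (i, 0)) = t.z i 0 := by simp [letterCount]

theorem letterCount_neg (t : FT) (i : ℕ) {j : ℕ} (hj : 1 ≤ j) :
    letterCount t (toLex (i, -(j : ℤ))) = t.y i j := by
  have : ¬ (0 : ℤ) ≤ -(j : ℤ) := by omega
  simp [letterCount]
  omega

theorem mem_letters {u v i : ℕ} {j : ℤ} :
    toLex (i, j) ∈ letters u v ↔ i ≤ u ∧ -(v : ℤ) ≤ j ∧ j ≤ v ∧ (i = 0 → 0 < j) := by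
  simp only [letters, List.mem_append, List.mem_map, List.mem_range'_1, List.mem_flatMap,
    List.mem_reverse, List.mem_singleton, toLex_inj, Prod.mk.injEq]
  constructor
  · rintro (⟨a, ha, h1, h2⟩ | ⟨a, ha, (⟨b, hb, h1, h2⟩ | ⟨h1, h2⟩) | ⟨b, hb, h1, h2⟩⟩) <;> omega
  · rintro ⟨h1, h2, h3, h4⟩
    rcases Nat.eq_zero_or_pos i with hi | hi
    · exact Or.inl ⟨j.toNat, by omega, by omega, by omega⟩
    · refine Or.inr ⟨i, by omega, ?_⟩
      rcases lt_trichotomy j 0 with hj | hj | hj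
      · exact Or.inl (Or.inl ⟨(-j).toNat, by omega, rfl, by omega⟩)
      · exact Or.inl (Or.inr ⟨rfl, hj⟩)
      · exact Or.inr ⟨j.toNat, by omega, rfl, by omega⟩

theorem pairwise_letters (u v : ℕ) : (letters u v).Pairwise (· < ·) := by
  have hr : ∀ k, (List.range' 1 k).Pairwise (· < ·) := fun k => List.pairwise_lt_range'
  rw [letters, List.pairwise_append, List.pairwise_map, List.pairwise_flatMap]
  refine ⟨?_, ⟨?_, ?_⟩, ?_⟩
  · exact (hr v).imp fun h => by rw [Prod.Lex.toLex_lt_toLex]; simp [h]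
  · intro i _
    rw [List.pairwise_append, List.pairwise_append, List.pairwise_map, List.pairwise_map,
      List.pairwise_reverse]
    refine ⟨⟨?_, by simp, ?_⟩, ?_, ?_⟩
    · exact (hr v).imp fun h => by rw [Prod.Lex.toLex_lt_toLex]; simp [h]
    · intro a ha b hb
      simp only [List.mem_map, List.mem_reverse, List.mem_range'_1, List.mem_singleton] at ha hb
      obtain ⟨j, hj, rfl⟩ := ha
      rw [hb, Prod.Lex.toLex_lt_toLex]
      right; simp; omega
    · exact (hr v).imp fun h => by rw [Prod.Lex.toLex_lt_toLex]; simp [h]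
    · intro a ha b hb
      simp only [List.mem_append, List.mem_map, List.mem_reverse, List.mem_range'_1,
        List.mem_singleton] at ha hb
      obtain ⟨k, hk, rfl⟩ := hb
      rcases ha with ⟨j, hj, rfl⟩ | rfl <;> rw [Prod.Lex.toLex_lt_toLex] <;> right <;> simp <;> omega
  · refine (hr u).imp fun {i i'} h => ?_
    intro a ha b hb
    simp only [List.mem_append, List.mem_map, List.mem_reverse, List.mem_range'_1,
      List.mem_singleton] at ha hb
    have h1 : (ofLex a).1 = i := by
      rcases ha with (⟨j, hj, rfl⟩ | rfl) | ⟨j, hj, rfl⟩ <;> rfl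
    have h2 : (ofLex b).1 = i' := by
      rcases hb with (⟨j, hj, rfl⟩ | rfl) | ⟨j, hj, rfl⟩ <;> rfl
    rw [← toLex_ofLex a, ← toLex_ofLex b, Prod.Lex.toLex_lt_toLex]
    left; omega
  · intro a ha b hb
    simp only [List.mem_append, List.mem_map, List.mem_reverse, List.mem_range'_1,
      List.mem_singleton, List.mem_flatMap] at ha hb
    obtain ⟨j, hj, rfl⟩ := ha
    obtain ⟨i, hi, hb⟩ := hb
    have h2 : (ofLex b).1 = i := by
      rcases hb with (⟨j, hj, rfl⟩ | rfl) | ⟨j, hj, rfl⟩ <;> rfl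
    rw [← toLex_ofLex b, Prod.Lex.toLex_lt_toLex]
    left; simp [h2]; omega

/-- The letters of a template with non-zero entries, preceded by the border letter `(0, 0)`. -/
def support (t : FT) : List (ℕ ×ₗ ℤ) :=
  toLex (0, 0) :: (letters t.u t.v).filter fun c => letterCount t c != 0

theorem pairwise_support (t : FT) : (support t).Pairwise (· < ·) := by
  rw [support, List.pairwise_cons]
  refine ⟨fun c hc => ?_, (pairwise_letters _ _).filter _⟩
  obtain ⟨⟨i, j⟩, rfl⟩ := toLex.surjective c
  have := mem_letters.1 (List.mem_filter.1 hc).1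
  rw [Prod.Lex.toLex_lt_toLex]
  simp only
  omega

/-- The reading word of a template without the prefix coming from `z_{00}`. -/
def bodyWord (t : FT) : List ℕ :=
  (((List.range' 1 t.v).map fun j => t.z 0 j) ++
    (List.range' 1 t.u).flatMap (rowWord t)).filter fun x => x != 0

theorem readWord_eq (t : FT) :
    readWord t = (if t.z 0 0 = 1 then [1] else []) ++ bodyWord t := rfl

theorem map_letterCount_letters (t : FT) :
    (letters t.u t.v).map (letterCount t) = ((List.range' 1 t.v).map fun j => t.z 0 j) ++
      (List.range' 1 t.u).flatMap (rowWord t) := by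
  have hrow : ∀ i, (((List.range' 1 t.v).reverse.map fun j : ℕ => toLex (i, -(j : ℤ))) ++
      [toLex (i, 0)] ++ (List.range' 1 t.v).map fun j : ℕ => toLex (i, (j : ℤ))).map
        (letterCount t) = rowWord t i := by
    intro i
    simp only [List.map_append, List.map_map, rowWord, List.map_singleton, letterCount_zero]
    congr 1
    · congr 1
      refine List.map_congr_left fun j hj => ?_
      simp only [List.mem_reverse, List.mem_range'_1] at hj
      exact letterCount_neg t i hj.1
  rw [letters, List.map_append, List.map_map, List.map_flatMap]
  congr 1
  simp only [hrow]

theorem bodyWord_eq (t : FT) : bodyWord t = (support t).tail.map (letterCount t) := by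
  rw [bodyWord, ← map_letterCount_letters, List.filter_map, support, List.tail_cons]
  rfl

theorem mem_support {t : FT} {c : ℕ ×ₗ ℤ} (hc : letterCount t c ≠ 0) : c ∈ support t := by
  rw [support, List.mem_cons, List.mem_filter]
  obtain ⟨⟨i, j⟩, rfl⟩ := toLex.surjective c
  by_cases h0 : i = 0 ∧ j = 0
  · left; rw [h0.1, h0.2]
  · refine Or.inr ⟨?_, by simpa using hc⟩
    rw [mem_letters]
    by_contra hm
    apply hc
    by_cases hj : 0 ≤ j
    · lift j to ℕ using hj
      rw [letterCount_natCast]; apply t.hz; omega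
    · obtain ⟨k, rfl⟩ : ∃ k : ℕ, j = -(k : ℤ) := ⟨(-j).toNat, by omega⟩
      rw [letterCount_neg t i (by omega)]; apply t.hy; omega

theorem pos_of_mem_bodyWord {t : FT} {x : ℕ} (hx : x ∈ bodyWord t) : 0 < x := by
  have := (List.mem_filter.1 hx).2
  simp at this
  omega

theorem sum_filter_ne_zero (l : List ℕ) : (l.filter fun x => x != 0).sum = l.sum := by
  induction l with
  | nil => rfl
  | cons a l ih =>
    by_cases h : a = 0
    · simp [h, ih]
    · simp [h, ih]

theorem sum_range'_map (f : ℕ → ℕ) (k : ℕ) :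
    ((List.range' 1 k).map f).sum = ∑ i ∈ Finset.Icc 1 k, f i := by
  induction k with
  | zero => rfl
  | succ k ih =>
    rw [List.range'_1_concat, List.map_append, List.sum_append, ih,
      Finset.sum_Icc_succ_top (by omega)]
    simp [add_comm]

theorem sum_bodyWord (t : FT) : (bodyWord t).sum = ∑ j ∈ Finset.Icc 1 t.v, t.z 0 j +
    ∑ i ∈ Finset.Icc 1 t.u, (t.z i 0 + ∑ j ∈ Finset.Icc 1 t.v, (t.y i j + t.z i j)) := by
  rw [bodyWord, sum_filter_ne_zero, List.sum_append, sum_range'_map]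
  congr 1
  rw [List.flatMap, List.sum_flatten, List.map_map, sum_range'_map]
  refine Finset.sum_congr rfl fun i _ => ?_
  simp only [Function.comp, rowWord, List.sum_append, List.map_reverse, List.sum_reverse,
    sum_range'_map, List.sum_singleton, Finset.sum_add_distrib]
  ring

/-- The filled templates with row and column sums prescribed by `q` and `p`. -/
def marginTemplates (n : ℕ) (p q : List ℕ) : Set FT :=
  {t | t.v = p.length ∧ t.u = q.length ∧
    (∀ j ∈ Finset.Icc 1 t.v,
      t.z 0 j + ∑ i ∈ Finset.Icc 1 t.u, (t.y i j + t.z i j) = p.getD (j - 1) 0) ∧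
    (∑ i ∈ Finset.Icc 0 t.u, t.z i 0 = n - p.sum) ∧
    (∀ i ∈ Finset.Icc 1 t.u,
      t.z i 0 + ∑ j ∈ Finset.Icc 1 t.v, (t.y i j + t.z i j) = q.getD (i - 1) 0) ∧
    (∑ j ∈ Finset.Icc 0 t.v, t.z 0 j = n - q.sum)}

theorem sum_Icc_getD (q : List ℕ) : ∑ i ∈ Finset.Icc 1 q.length, q.getD (i - 1) 0 = q.sum := by
  have : ∀ k, ∑ i ∈ Finset.Icc 1 k, q.getD (i - 1) 0 = psum q k := by
    intro k
    induction k with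
    | zero => simp
    | succ k ih => rw [Finset.sum_Icc_succ_top (by omega), ih, psum_succ]; simp
  rw [this, psum_of_length_le le_rfl]

theorem sum_Icc_zero (f : ℕ → ℕ) (k : ℕ) :
    ∑ i ∈ Finset.Icc 0 k, f i = f 0 + ∑ i ∈ Finset.Icc 1 k, f i := by
  induction k with
  | zero => simp
  | succ k ih =>
    rw [Finset.sum_Icc_succ_top (by omega), Finset.sum_Icc_succ_top (by omega), ih, add_assoc]

theorem sum_bodyWord_of_mem {n : ℕ} {p q : List ℕ} (hq : q.sum ≤ n) {t : FT}
    (ht : t ∈ marginTemplates n p q) : (bodyWord t).sum + t.z 0 0 = n := by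
  obtain ⟨-, hu, -, -, h3, h4⟩ := ht
  rw [sum_bodyWord, Finset.sum_congr rfl h3, hu, sum_Icc_getD]
  rw [sum_Icc_zero] at h4
  omega

/-- The monotone letter function associated with a template. -/
noncomputable def letterFn (n : ℕ) (t : FT) (x : Fin n) : ℕ ×ₗ ℤ :=
  (support t).getD (level n (bodyWord t) x) (toLex (0, 0))

theorem length_support (t : FT) : (support t).length = (bodyWord t).length + 1 := by
  rw [bodyWord_eq]; simp [support]

theorem letterFn_eq {n : ℕ} (t : FT) (x : Fin n) :
    letterFn n t x = (support t)[level n (bodyWord t) x]'(by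
      rw [length_support]; have := level_le n (bodyWord t) x; omega) := by
  rw [letterFn, List.getD_eq_getElem]

theorem letterFn_monotone (n : ℕ) (t : FT) : Monotone (letterFn n t) := by
  intro x y h
  rw [letterFn_eq, letterFn_eq]
  rcases (level_mono n (bodyWord t) h).eq_or_lt with h' | h'
  · simp [h']
  · exact (List.pairwise_iff_getElem.1 (pairwise_support t) _ _ _ _ h').le

theorem letterFn_eq_letterFn_iff {n : ℕ} {t : FT} {x y : Fin n} :
    letterFn n t x = letterFn n t y ↔ level n (bodyWord t) x = level n (bodyWord t) y := by
  have hnd : (support t).Nodup := (pairwise_support t).imp ne_of_lt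
  rw [letterFn_eq, letterFn_eq, hnd.getElem_inj_iff]

theorem letterFn_eq_zero_iff {n : ℕ} {t : FT} {x : Fin n} :
    letterFn n t x = toLex (0, 0) ↔ level n (bodyWord t) x = 0 := by
  have hnd : (support t).Nodup := (pairwise_support t).imp ne_of_lt
  have h0 : (toLex (0, 0) : ℕ ×ₗ ℤ) = (support t)[0]'(by rw [length_support]; omega) := rfl
  rw [letterFn_eq, h0, hnd.getElem_inj_iff]

theorem mem_support_bounds {t : FT} {i : ℕ} {j : ℤ} (h : toLex (i, j) ∈ support t) :
    i ≤ t.u ∧ -(t.v : ℤ) ≤ j ∧ j ≤ t.v ∧ (i = 0 → 0 ≤ j) := by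
  rw [support, List.mem_cons, List.mem_filter, mem_letters, toLex_inj, Prod.mk.injEq] at h
  omega

theorem letterFn_mem_support {n : ℕ} (t : FT) (x : Fin n) : letterFn n t x ∈ support t := by
  rw [letterFn_eq]
  exact List.getElem_mem _

theorem fiberCard_eq_zero {N : ℕ} {α : Type*} {f : Fin N → α} {c : α} (h : ∀ x, f x ≠ c) :
    fiberCard f c = 0 := by
  rw [fiberCard, Finset.card_eq_zero, Finset.filter_eq_empty_iff]
  exact fun x _ => h x

theorem fiberCard_letterFn {n : ℕ} {t : FT} (ht : (bodyWord t).sum + t.z 0 0 = n)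
    (c : ℕ ×ₗ ℤ) : fiberCard (letterFn n t) c = letterCount t c := by
  have hnd : (support t).Nodup := (pairwise_support t).imp ne_of_lt
  by_cases hc : c ∈ support t
  · obtain ⟨k, hk, rfl⟩ := List.getElem_of_mem hc
    have h1 : fiberCard (letterFn n t) (support t)[k] =
        fiberCard (fun x : Fin n => level n (bodyWord t) x) k := by
      unfold fiberCard
      congr! 3 with x
      rw [letterFn_eq, hnd.getElem_inj_iff]
    rw [h1, fiberCard_level (by omega), blockSize]
    split_ifs with h0
    · subst h0
      have : (support t)[0] = toLex (0, 0) := rfl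
      rw [this, letterCount_zero]
      omega
    · obtain ⟨k, rfl⟩ := Nat.exists_eq_succ_of_ne_zero h0
      rw [List.getD_eq_getElem _ _ (by rw [length_support] at hk; simp; omega)]
      simp [bodyWord_eq]
  · have h2 : letterCount t c = 0 := by
      by_contra h
      exact hc (mem_support h)
    rw [h2]
    refine fiberCard_eq_zero fun x hx => hc ?_
    rw [← hx]
    exact letterFn_mem_support t x

theorem FT.ext_of_letterCount {t t' : FT} (hu : t.u = t'.u) (hv : t.v = t'.v)
    (h : ∀ c, letterCount t c = letterCount t' c) : t = t' := by
  have hz : t.z = t'.z := by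
    ext i j
    rw [← letterCount_natCast, ← letterCount_natCast, h]
  have hy : t.y = t'.y := by
    ext i j
    rcases Nat.eq_zero_or_pos j with rfl | hj
    · rw [t.hy _ _ (by simp), t'.hy _ _ (by simp)]
    · rw [← letterCount_neg _ _ hj, ← letterCount_neg _ _ hj, h]
  cases t; cases t'; simp_all

/-- The letter function `k` has values among the letters of a template of shape `(u, v)`. -/
def IsLetterFn {n : ℕ} (u v : ℕ) (k : Fin n → ℕ ×ₗ ℤ) : Prop :=
  ∀ x, (ofLex (k x)).1 ≤ u ∧ (ofLex (k x)).2.natAbs ≤ v ∧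
    ((ofLex (k x)).1 = 0 → 0 ≤ (ofLex (k x)).2)

theorem isLetterFn_letterFn (n : ℕ) (t : FT) : IsLetterFn t.u t.v (letterFn n t) := by
  intro x
  have h := letterFn_mem_support t x
  obtain ⟨⟨i, j⟩, hx⟩ := toLex.surjective (letterFn n t x)
  rw [← hx] at h ⊢
  have := mem_support_bounds h
  simp only [ofLex_toLex]
  omega

/-- The template recording the fibre cardinalities of a letter function. -/
noncomputable def countTemplate {n : ℕ} (u v : ℕ) (k : Fin n → ℕ ×ₗ ℤ) : FT where
  u := u
  v := v
  z i j := if i ≤ u ∧ j ≤ v then fiberCard k (toLex (i, (j : ℤ))) else 0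
  y i j := if i ≠ 0 ∧ j ≠ 0 ∧ i ≤ u ∧ j ≤ v then fiberCard k (toLex (i, -(j : ℤ))) else 0
  hz i j h := by rw [if_neg]; omega
  hy i j h := by rw [if_neg]; omega

theorem letterCount_countTemplate {n u v : ℕ} {k : Fin n → ℕ ×ₗ ℤ} (hk : IsLetterFn u v k)
    (c : ℕ ×ₗ ℤ) : letterCount (countTemplate u v k) c = fiberCard k c := by
  obtain ⟨⟨i, j⟩, rfl⟩ := toLex.surjective c
  have key : ¬(i ≤ u ∧ j.natAbs ≤ v ∧ (i = 0 → 0 ≤ j)) → fiberCard k (toLex (i, j)) = 0 := by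
    intro h
    refine fiberCard_eq_zero fun x hx => h ?_
    have := hk x
    rwa [hx] at this
  by_cases hj : 0 ≤ j
  · lift j to ℕ using hj
    rw [letterCount_natCast]
    simp only [countTemplate]
    split_ifs with h
    · rfl
    · rw [key (by simp; omega)]
  · obtain ⟨m, rfl⟩ : ∃ m : ℕ, j = -(m : ℤ) := ⟨(-j).toNat, by omega⟩
    rw [letterCount_neg _ _ (by omega)]
    simp only [countTemplate]
    split_ifs with h
    · rfl
    · rw [key (by omega)]

theorem fiberCard_eq_sum {N : ℕ} {α : Type*} (f : Fin N → α) (c : α) :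
    fiberCard f c = ∑ x, if f x = c then 1 else 0 := by
  rw [fiberCard, Finset.card_filter]

theorem lex_eq_iff {c : ℕ ×ₗ ℤ} {i : ℕ} {j : ℤ} :
    c = toLex (i, j) ↔ (ofLex c).1 = i ∧ (ofLex c).2 = j := by
  obtain ⟨⟨a, b⟩, rfl⟩ := toLex.surjective c
  rw [toLex_inj, Prod.mk.injEq, ofLex_toLex]

theorem row_sum {n u v : ℕ} {k : Fin n → ℕ ×ₗ ℤ} (hk : IsLetterFn u v k) {t : FT}
    (ht : ∀ c, letterCount t c = fiberCard k c) (i : ℕ) :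
    t.z i 0 + ∑ j ∈ Finset.Icc 1 v, (t.y i j + t.z i j) =
      fiberCard (fun x => (ofLex (k x)).1) i := by
  have h1 : ∀ j ∈ Finset.Icc 1 v, t.y i j + t.z i j =
      ∑ x, if (ofLex (k x)).1 = i ∧ (ofLex (k x)).2.natAbs = j then 1 else 0 := by
    intro j hj
    rw [Finset.mem_Icc] at hj
    rw [← letterCount_neg t i hj.1, ← letterCount_natCast, ht, ht, fiberCard_eq_sum,
      fiberCard_eq_sum, ← Finset.sum_add_distrib]
    refine Finset.sum_congr rfl fun x _ => ?_
    simp only [lex_eq_iff]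
    split_ifs <;> omega
  rw [Finset.sum_congr rfl h1, Finset.sum_comm, ← letterCount_zero, ht, fiberCard_eq_sum,
    fiberCard_eq_sum, ← Finset.sum_add_distrib]
  refine Finset.sum_congr rfl fun x _ => ?_
  simp only [lex_eq_iff, ite_and]
  have := hk x
  split_ifs with h h'
  · simp [h']
  · rw [Finset.sum_ite_eq, if_pos]
    rw [Finset.mem_Icc]; omega
  · simp

theorem row_zero_sum {n u v : ℕ} {k : Fin n → ℕ ×ₗ ℤ} (hk : IsLetterFn u v k) {t : FT}
    (ht : ∀ c, letterCount t c = fiberCard k c) :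
    ∑ j ∈ Finset.Icc 0 v, t.z 0 j = fiberCard (fun x => (ofLex (k x)).1) 0 := by
  have h1 : ∀ j ∈ Finset.Icc 0 v, t.z 0 j =
      ∑ x, if (ofLex (k x)).1 = 0 ∧ (ofLex (k x)).2.natAbs = j then 1 else 0 := by
    intro j hj
    rw [← letterCount_natCast, ht, fiberCard_eq_sum]
    refine Finset.sum_congr rfl fun x _ => ?_
    have := hk x
    simp only [lex_eq_iff]
    split_ifs <;> omega
  rw [Finset.sum_congr rfl h1, Finset.sum_comm, fiberCard_eq_sum]
  refine Finset.sum_congr rfl fun x _ => ?_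
  simp only [ite_and]
  have := hk x
  split_ifs with h
  · rw [Finset.sum_ite_eq, if_pos]
    rw [Finset.mem_Icc]; omega
  · simp

theorem col_sum {n u v : ℕ} {k : Fin n → ℕ ×ₗ ℤ} (hk : IsLetterFn u v k) {t : FT}
    (ht : ∀ c, letterCount t c = fiberCard k c) {j : ℕ} (hj : 1 ≤ j) :
    t.z 0 j + ∑ i ∈ Finset.Icc 1 u, (t.y i j + t.z i j) =
      fiberCard (fun x => (ofLex (k x)).2.natAbs) j := by
  have h1 : ∀ i ∈ Finset.Icc 1 u, t.y i j + t.z i j =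
      ∑ x, if (ofLex (k x)).2.natAbs = j ∧ (ofLex (k x)).1 = i then 1 else 0 := by
    intro i hi
    rw [← letterCount_neg t i hj, ← letterCount_natCast, ht, ht, fiberCard_eq_sum,
      fiberCard_eq_sum, ← Finset.sum_add_distrib]
    refine Finset.sum_congr rfl fun x _ => ?_
    simp only [lex_eq_iff]
    split_ifs <;> omega
  rw [Finset.sum_congr rfl h1, Finset.sum_comm, ← letterCount_natCast, ht, fiberCard_eq_sum,
    fiberCard_eq_sum, ← Finset.sum_add_distrib]
  refine Finset.sum_congr rfl fun x _ => ?_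
  simp only [lex_eq_iff, ite_and]
  have := hk x
  by_cases h : (ofLex (k x)).2.natAbs = j
  · simp only [if_pos h]
    rw [Finset.sum_ite_eq]
    simp only [Finset.mem_Icc]
    split_ifs <;> omega
  · simp only [if_neg h, Finset.sum_const_zero]
    split_ifs <;> omega

theorem col_zero_sum {n u v : ℕ} {k : Fin n → ℕ ×ₗ ℤ} (hk : IsLetterFn u v k) {t : FT}
    (ht : ∀ c, letterCount t c = fiberCard k c) :
    ∑ i ∈ Finset.Icc 0 u, t.z i 0 = fiberCard (fun x => (ofLex (k x)).2.natAbs) 0 := by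
  have h1 : ∀ i ∈ Finset.Icc 0 u, t.z i 0 =
      ∑ x, if (ofLex (k x)).2.natAbs = 0 ∧ (ofLex (k x)).1 = i then 1 else 0 := by
    intro i hi
    rw [← letterCount_zero, ht, fiberCard_eq_sum]
    refine Finset.sum_congr rfl fun x _ => ?_
    simp only [lex_eq_iff]
    split_ifs <;> omega
  rw [Finset.sum_congr rfl h1, Finset.sum_comm, fiberCard_eq_sum]
  refine Finset.sum_congr rfl fun x _ => ?_
  simp only [ite_and]
  have := hk x
  split_ifs with h
  · rw [Finset.sum_ite_eq, if_pos]
    rw [Finset.mem_Icc]; omega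
  · simp

theorem mem_marginTemplates_iff {n : ℕ} {p q : List ℕ} {k : Fin n → ℕ ×ₗ ℤ}
    (hk : IsLetterFn q.length p.length k) {t : FT} (hu : t.u = q.length) (hv : t.v = p.length)
    (ht : ∀ c, letterCount t c = fiberCard k c) :
    t ∈ marginTemplates n p q ↔
      (∀ i, fiberCard (fun x => (ofLex (k x)).1) i = blockSize n q i) ∧
        ∀ j, fiberCard (fun x => (ofLex (k x)).2.natAbs) j = blockSize n p j := by
  have hi : ∀ i, q.length < i →
      fiberCard (fun x => (ofLex (k x)).1) i = blockSize n q i := by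
    intro i h
    rw [fiberCard_eq_zero (fun x => by have := hk x; omega), blockSize, if_neg (by omega),
      List.getD_eq_default _ _ (by omega)]
  have hj : ∀ j, p.length < j →
      fiberCard (fun x => (ofLex (k x)).2.natAbs) j = blockSize n p j := by
    intro j h
    rw [fiberCard_eq_zero (fun x => by have := hk x; omega), blockSize, if_neg (by omega),
      List.getD_eq_default _ _ (by omega)]
  simp only [marginTemplates, Set.mem_ofPred_eq, hu, hv, true_and]
  rw [row_zero_sum hk ht, col_zero_sum hk ht]
  constructor
  · rintro ⟨h1, h2, h3, h4⟩
    refine ⟨fun i => ?_, fun j => ?_⟩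
    · rcases Nat.eq_zero_or_pos i with rfl | h0
      · exact h4
      · by_cases h : q.length < i
        · exact hi i h
        · rw [← row_sum hk ht, h3 i (Finset.mem_Icc.2 ⟨h0, by omega⟩), blockSize, if_neg (by omega)]
    · rcases Nat.eq_zero_or_pos j with rfl | h0
      · exact h2
      · by_cases h : p.length < j
        · exact hj j h
        · rw [← col_sum hk ht h0, h1 j (Finset.mem_Icc.2 ⟨h0, by omega⟩), blockSize,
            if_neg (by omega)]
  · rintro ⟨h1, h2⟩
    refine ⟨fun j h => ?_, h2 0, fun i h => ?_, h1 0⟩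
    · rw [Finset.mem_Icc] at h
      rw [col_sum hk ht h.1, h2, blockSize, if_neg (by omega)]
    · rw [Finset.mem_Icc] at h
      rw [row_sum hk ht, h1, blockSize, if_neg (by omega)]

/-! ### The multiplication bijection -/

theorem fiberCard_even {n : ℕ} {α : Type*} {G : Fin (n + n) → α} (hG : ∀ x, G x.rev = G x) (c : α) :
    fiberCard G c = 2 * fiberCard (fun x => G (pos x)) c := by
  rw [fiberCard_eq_sum, sum_univ_pos, fiberCard_eq_sum]
  simp only [hG]
  ring

theorem fiberCard_odd_natAbs {n : ℕ} {F : Fin (n + n) → ℤ} (hF : ∀ x, F x.rev = -F x) (c : ℤ) :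
    fiberCard F c = (if c = 0 then 2 else 1) * fiberCard (fun x => (F (pos x)).natAbs) c.natAbs := by
  rw [fiberCard_odd hF, fiberCard_eq_sum, fiberCard_eq_sum, fiberCard_eq_sum,
    ← Finset.sum_add_distrib, Finset.mul_sum]
  refine Finset.sum_congr rfl fun x _ => ?_
  split_ifs <;> omega

theorem fiberCard_natAbs_blockFn_comp {n : ℕ} {p : List ℕ} (hp : p.sum ≤ n)
    {b : Equiv.Perm (Fin (n + n))} (hb : b ∈ signedPerms n) (j : ℕ) :
    fiberCard (fun x => (blockFn n p (b (pos x))).natAbs) j = blockSize n p j := by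
  have h1 := fiberCard_even (G := fun x => (blockFn n p x).natAbs)
    (fun x => by simp [blockFn_rev]) j
  have h2 := fiberCard_even (G := (fun x => (blockFn n p x).natAbs) ∘ b)
    (fun x => by simp [blockFn_rev, hb x]) j
  rw [fiberCard_comp_perm, h1] at h2
  have h3 : fiberCard (fun x : Fin n => (blockFn n p (pos x)).natAbs) j = blockSize n p j := by
    rw [← fiberCard_level hp]
    simp
  rw [← h3]
  simp only [Function.comp_apply] at h2
  omega

/-- The letter function recording the positions of the blocks of `q` and `p` under `b`. -/
noncomputable def jointFn (n : ℕ) (p q : List ℕ) (b : Equiv.Perm (Fin (n + n))) (x : Fin n) :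
    ℕ ×ₗ ℤ :=
  toLex (level n q x, blockFn n p (b (pos x)))

/-- The template attached to a signed permutation. -/
noncomputable def templateOf (n : ℕ) (p q : List ℕ) (b : Equiv.Perm (Fin (n + n))) : FT :=
  countTemplate q.length p.length (jointFn n p q b)

theorem blockFn_pos_nonneg {n : ℕ} (q : List ℕ) (x : Fin n) : 0 ≤ blockFn n q (pos x) := by
  rw [blockFn_pos]; positivity

theorem natAbs_blockFn_le {n : ℕ} (q : List ℕ) (x : Fin (n + n)) :
    (blockFn n q x).natAbs ≤ q.length := by
  obtain ⟨y, rfl⟩ | ⟨y, rfl⟩ := eq_pos_or_eq_rev_pos x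
  · simpa using level_le n q y
  · simpa [blockFn_rev] using level_le n q y

theorem blockFn_nonneg_of_level_eq_zero {n : ℕ} {p q : List ℕ} {b : Equiv.Perm (Fin (n + n))}
    (hb : b ∈ signedPerms n) (hbq : IncrOnFibers (blockFn n q) b) {x : Fin n}
    (hx : level n q x = 0) : 0 ≤ blockFn n p (b (pos x)) := by
  have h := hbq _ _ (rev_pos_lt_pos x x) (by simp [blockFn_rev, hx])
  rw [hb] at h
  obtain ⟨y, hy⟩ | ⟨y, hy⟩ := eq_pos_or_eq_rev_pos (b (pos x))
  · rw [hy]; exact blockFn_pos_nonneg p y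
  · rw [hy, Fin.rev_rev] at h
    exact absurd h (rev_pos_lt_pos y y).not_gt

theorem isLetterFn_jointFn {n : ℕ} {p q : List ℕ} {b : Equiv.Perm (Fin (n + n))}
    (hb : b ∈ signedPerms n) (hbq : IncrOnFibers (blockFn n q) b) :
    IsLetterFn q.length p.length (jointFn n p q b) := fun x =>
  ⟨level_le n q x, natAbs_blockFn_le p _, fun h => blockFn_nonneg_of_level_eq_zero hb hbq h⟩

theorem jointFn_monotone {n : ℕ} (p : List ℕ) {q : List ℕ} {b : Equiv.Perm (Fin (n + n))}
    (hbq : IncrOnFibers (blockFn n q) b) : Monotone (jointFn n p q b) := by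
  intro x y hxy
  rcases hxy.eq_or_lt with rfl | hxy
  · exact le_rfl
  rw [jointFn, jointFn, Prod.Lex.toLex_le_toLex]
  rcases (level_mono n q hxy.le).eq_or_lt with h | h
  · exact Or.inr ⟨h, blockFn_monotone n p (hbq _ _ (pos_lt_pos.2 hxy) (by simp [h])).le⟩
  · exact Or.inl h

theorem templateOf_mem {n : ℕ} {p q : List ℕ} (hp : p.sum ≤ n) (hq : q.sum ≤ n)
    {b : Equiv.Perm (Fin (n + n))} (hb : b ∈ signedPerms n)
    (hbq : IncrOnFibers (blockFn n q) b) : templateOf n p q b ∈ marginTemplates n p q :=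
  (mem_marginTemplates_iff (isLetterFn_jointFn hb hbq) rfl rfl
    (letterCount_countTemplate (isLetterFn_jointFn hb hbq))).2
    ⟨fun i => fiberCard_level hq i, fun j => fiberCard_natAbs_blockFn_comp hp hb j⟩

theorem letterFn_templateOf {n : ℕ} {p q : List ℕ} (hp : p.sum ≤ n) (hq : q.sum ≤ n)
    {b : Equiv.Perm (Fin (n + n))} (hb : b ∈ signedPerms n)
    (hbq : IncrOnFibers (blockFn n q) b) :
    letterFn n (templateOf n p q b) = jointFn n p q b := by
  refine eq_of_monotone_of_fiberCard_eq (letterFn_monotone _ _) (jointFn_monotone p hbq) fun c => ?_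
  rw [fiberCard_letterFn (sum_bodyWord_of_mem hq (templateOf_mem hp hq hb hbq)), templateOf,
    letterCount_countTemplate (isLetterFn_jointFn hb hbq)]

section

variable {n : ℕ} {p q : List ℕ} {t : FT}

theorem isLetterFn_of_mem (ht : t ∈ marginTemplates n p q) :
    IsLetterFn q.length p.length (letterFn n t) := by
  rw [← ht.1, ← ht.2.1]
  exact isLetterFn_letterFn n t

theorem letterFn_fst (hq : q.sum ≤ n) (ht : t ∈ marginTemplates n p q) (x : Fin n) :
    (ofLex (letterFn n t x)).1 = level n q x := by
  have h := ((mem_marginTemplates_iff (isLetterFn_of_mem ht) ht.2.1 ht.1 fun c =>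
    (fiberCard_letterFn (sum_bodyWord_of_mem hq ht) c).symm).1 ht).1
  refine congrFun (eq_of_monotone_of_fiberCard_eq (f := fun x => (ofLex (letterFn n t x)).1)
    (g := fun x : Fin n => level n q x) ?_ (fun x y h => level_mono n q h) fun c => ?_) x
  · intro x y hxy
    exact Prod.Lex.monotone_fst _ _ (letterFn_monotone n t hxy)
  · rw [h, fiberCard_level hq]

/-- The odd function on `Fin (n + n)` recording the columns of the letters of a template. -/
noncomputable def columnFn (n : ℕ) (t : FT) : Fin (n + n) → ℤ :=
  oddExt fun x => (ofLex (letterFn n t x)).2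

theorem columnFn_rev (t : FT) (x : Fin (n + n)) : columnFn n t x.rev = -columnFn n t x :=
  oddExt_rev _ x

theorem letterFn_eq_toLex (hq : q.sum ≤ n) (ht : t ∈ marginTemplates n p q) (x : Fin n) :
    letterFn n t x = toLex (level n q x, columnFn n t (pos x)) := by
  rw [lex_eq_iff, letterFn_fst hq ht, columnFn, oddExt_pos]
  exact ⟨rfl, rfl⟩

theorem columnFn_nonneg (hq : q.sum ≤ n) (ht : t ∈ marginTemplates n p q) {x : Fin n}
    (hx : level n q x = 0) : 0 ≤ columnFn n t (pos x) := by
  rw [columnFn, oddExt_pos]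
  exact (isLetterFn_of_mem ht x).2.2 (by rw [letterFn_fst hq ht, hx])

theorem blockFn_bodyWord_eq_iff (hq : q.sum ≤ n) (ht : t ∈ marginTemplates n p q)
    (x y : Fin (n + n)) :
    blockFn n (bodyWord t) x = blockFn n (bodyWord t) y ↔
      blockFn n q x = blockFn n q y ∧ columnFn n t x = columnFn n t y := by
  have hpos : ∀ x y : Fin n, level n (bodyWord t) x = level n (bodyWord t) y ↔
      level n q x = level n q y ∧ columnFn n t (pos x) = columnFn n t (pos y) := by
    intro x y
    rw [← letterFn_eq_letterFn_iff, letterFn_eq_toLex hq ht, letterFn_eq_toLex hq ht, toLex_inj,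
      Prod.mk.injEq]
  have hzero : ∀ x : Fin n, level n (bodyWord t) x = 0 ↔
      level n q x = 0 ∧ columnFn n t (pos x) = 0 := by
    intro x
    rw [← letterFn_eq_zero_iff, letterFn_eq_toLex hq ht, toLex_inj, Prod.mk.injEq]
  have hcross : ∀ x y : Fin n, (-(level n (bodyWord t) x : ℤ) = level n (bodyWord t) y) ↔
      -(level n q x : ℤ) = level n q y ∧ -columnFn n t (pos x) = columnFn n t (pos y) := by
    intro x y
    have h1 := hzero x
    have h2 := hzero y
    have h3 := fun h => columnFn_nonneg hq ht (x := x) h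
    have h4 := fun h => columnFn_nonneg hq ht (x := y) h
    omega
  obtain ⟨x, rfl⟩ | ⟨x, rfl⟩ := eq_pos_or_eq_rev_pos x <;>
    obtain ⟨y, rfl⟩ | ⟨y, rfl⟩ := eq_pos_or_eq_rev_pos y <;>
    simp only [blockFn_rev, columnFn_rev, blockFn_pos, neg_inj, Nat.cast_inj]
  · exact hpos x y
  · rw [eq_comm, hcross, eq_comm, @eq_comm _ (columnFn n t (pos x))]
  · exact hcross x y
  · exact hpos x y

theorem columnFn_le_of_blockFn_eq (hq : q.sum ≤ n) (ht : t ∈ marginTemplates n p q)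
    {x y : Fin (n + n)} (hxy : x < y) (h : blockFn n q x = blockFn n q y) :
    columnFn n t x ≤ columnFn n t y := by
  have hpos : ∀ x y : Fin n, x < y → level n q x = level n q y →
      columnFn n t (pos x) ≤ columnFn n t (pos y) := by
    intro x y hxy h
    have := letterFn_monotone n t hxy.le
    rw [letterFn_eq_toLex hq ht, letterFn_eq_toLex hq ht, Prod.Lex.toLex_le_toLex] at this
    simp only at this
    omega
  obtain ⟨x, rfl⟩ | ⟨x, rfl⟩ := eq_pos_or_eq_rev_pos x <;>
    obtain ⟨y, rfl⟩ | ⟨y, rfl⟩ := eq_pos_or_eq_rev_pos y <;>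
    simp only [blockFn_rev, columnFn_rev, blockFn_pos, neg_inj, Nat.cast_inj, neg_le_neg_iff] at h ⊢
  · exact hpos x y (pos_lt_pos.1 hxy) h
  · exact absurd hxy (rev_pos_lt_pos y x).not_gt
  · have h1 := columnFn_nonneg hq ht (x := x) (by omega)
    have h2 := columnFn_nonneg hq ht (x := y) (by omega)
    omega
  · exact hpos y x (pos_lt_pos.1 (Fin.rev_lt_rev.1 hxy)) h.symm

theorem columnFn_templateOf (hp : p.sum ≤ n) (hq : q.sum ≤ n)
    {b : Equiv.Perm (Fin (n + n))} (hb : b ∈ signedPerms n)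
    (hbq : IncrOnFibers (blockFn n q) b) :
    columnFn n (templateOf n p q b) = blockFn n p ∘ b := by
  refine eq_of_odd (columnFn_rev _) (fun x => by simp [hb x, blockFn_rev]) fun x => ?_
  rw [columnFn, oddExt_pos, letterFn_templateOf hp hq hb hbq, jointFn, ofLex_toLex]
  rfl

theorem incrOnFibers_mul (hp : p.sum ≤ n) (hq : q.sum ≤ n)
    {a b : Equiv.Perm (Fin (n + n))} (hap : IncrOnFibers (blockFn n p) a) (hb : b ∈ signedPerms n)
    (hbq : IncrOnFibers (blockFn n q) b) :
    IncrOnFibers (blockFn n (bodyWord (templateOf n p q b))) (a * b) := by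
  intro x y hxy h
  rw [blockFn_bodyWord_eq_iff hq (templateOf_mem hp hq hb hbq),
    columnFn_templateOf hp hq hb hbq] at h
  exact hap _ _ (hbq x y hxy h.1) h.2

theorem exists_factorization (hp : p.sum ≤ n) (hq : q.sum ≤ n) (ht : t ∈ marginTemplates n p q)
    {g : Equiv.Perm (Fin (n + n))} (hg : g ∈ signedPerms n)
    (hgt : IncrOnFibers (blockFn n (bodyWord t)) g) :
    ∃ a b, a ∈ signedPerms n ∧ IncrOnFibers (blockFn n p) a ∧ b ∈ signedPerms n ∧
      IncrOnFibers (blockFn n q) b ∧ templateOf n p q b = t ∧ a * b = g := by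
  set F := columnFn n t ∘ ⇑g⁻¹ with hF
  have hodd : ∀ x, F x.rev = -F x := by
    intro x
    simp only [hF, Function.comp_apply]
    rw [(signedPerms n).inv_mem hg x, columnFn_rev]
  obtain ⟨hm, hs⟩ := Tuple.eq_sort_iff.1 (rfl : Tuple.sort F = Tuple.sort F)
  have ha := sort_mem_signedPerms hodd
  set a := Tuple.sort F
  have hcol := ((mem_marginTemplates_iff (isLetterFn_of_mem ht) ht.2.1 ht.1 fun c =>
    (fiberCard_letterFn (sum_bodyWord_of_mem hq ht) c).symm).1 ht).2
  have hFa : F ∘ a = blockFn n p := by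
    refine eq_of_monotone_of_fiberCard_eq hm (blockFn_monotone n p) fun c => ?_
    rw [fiberCard_comp_perm, hF, fiberCard_comp_perm, fiberCard_odd_natAbs (columnFn_rev t),
      fiberCard_odd_natAbs (blockFn_rev p)]
    congr 1
    simp only [columnFn, oddExt_pos]
    rw [hcol]
    exact (fiberCard_natAbs_blockFn_comp hp (signedPerms n).one_mem _).symm
  have hFa' : ∀ x, blockFn n p ((a⁻¹ * g) x) = columnFn n t x := by
    intro x
    rw [← hFa]
    simp [hF]
  have hap : IncrOnFibers (blockFn n p) a := by
    intro x y hxy h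
    rw [← hFa] at h
    exact hs x y hxy h
  have hb : a⁻¹ * g ∈ signedPerms n := mul_mem (inv_mem ha) hg
  have hbq : IncrOnFibers (blockFn n q) (a⁻¹ * g) := by
    intro x y hxy h
    rcases lt_trichotomy ((a⁻¹ * g) x) ((a⁻¹ * g) y) with h1 | h1 | h1
    · exact h1
    · exact absurd ((a⁻¹ * g).injective h1) hxy.ne
    · exfalso
      have h2 := blockFn_monotone n p h1.le
      rw [hFa', hFa'] at h2
      have h3 := le_antisymm (columnFn_le_of_blockFn_eq hq ht hxy h) h2
      have h4 := hgt x y hxy ((blockFn_bodyWord_eq_iff hq ht x y).2 ⟨h, h3⟩)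
      have h5 := hap _ _ h1 (by rw [hFa', hFa', h3])
      simp at h5
      exact h5.not_gt h4
  refine ⟨a, a⁻¹ * g, ha, hap, hb, hbq, ?_, by simp⟩
  refine FT.ext_of_letterCount ht.2.1.symm ht.1.symm fun c => ?_
  rw [templateOf, letterCount_countTemplate (isLetterFn_jointFn hb hbq),
    ← fiberCard_letterFn (sum_bodyWord_of_mem hq ht)]
  congr 1
  ext1 x
  rw [jointFn, hFa', letterFn_eq_toLex hq ht]

theorem factorization_unique (hp : p.sum ≤ n) (hq : q.sum ≤ n)
    {a b a' b' : Equiv.Perm (Fin (n + n))}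
    (hap : IncrOnFibers (blockFn n p) a) (hb : b ∈ signedPerms n)
    (hbq : IncrOnFibers (blockFn n q) b)
    (hap' : IncrOnFibers (blockFn n p) a') (hb' : b' ∈ signedPerms n)
    (hbq' : IncrOnFibers (blockFn n q) b') (h : templateOf n p q b = templateOf n p q b')
    (hab : a * b = a' * b') : a = a' ∧ b = b' := by
  have h1 : blockFn n p ∘ b = blockFn n p ∘ b' := by
    rw [← columnFn_templateOf hp hq hb hbq, h, columnFn_templateOf hp hq hb' hbq']
  have e : ∀ {a b : Equiv.Perm (Fin (n + n))}, blockFn n p ∘ ⇑a⁻¹ =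
      (blockFn n p ∘ b) ∘ ⇑(a * b)⁻¹ := by
    intro a b; ext x; simp
  have h2 : a = a' := by
    rw [hap.eq_sort (blockFn_monotone n p), hap'.eq_sort (blockFn_monotone n p), e (b := b), h1, hab,
      ← e]
  subst h2
  exact ⟨rfl, mul_left_cancel hab⟩

end

/-- The signed permutations increasing on the blocks of `q`. -/
noncomputable def incrPerms (n : ℕ) (q : List ℕ) : Finset (Equiv.Perm (Fin (n + n))) :=
  Finset.univ.filter fun w => w ∈ signedPerms n ∧ IncrOnFibers (blockFn n q) w

theorem mem_incrPerms {n : ℕ} {q : List ℕ} {w : Equiv.Perm (Fin (n + n))} :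
    w ∈ incrPerms n q ↔ w ∈ signedPerms n ∧ IncrOnFibers (blockFn n q) w := by
  simp [incrPerms]

theorem marginTemplates_finite {n : ℕ} {p q : List ℕ} (hp : p.sum ≤ n) (hq : q.sum ≤ n) :
    (marginTemplates n p q).Finite := by
  refine (Set.finite_range (templateOf n p q)).subset fun t ht => ?_
  obtain ⟨a, b, -, -, -, -, h, -⟩ := exists_factorization hp hq ht (one_mem _)
    (fun x y hxy _ => hxy)
  exact ⟨b, h⟩

theorem sum_incrPerms_product {n : ℕ} {p q : List ℕ} (hp : p.sum ≤ n) (hq : q.sum ≤ n) {M : Type*}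
    [AddCommMonoid M] (f : FT → Equiv.Perm (Fin (n + n)) → M) :
    ∑ a ∈ incrPerms n p, ∑ b ∈ incrPerms n q, f (templateOf n p q b) (a * b) =
      ∑ t ∈ (marginTemplates_finite hp hq).toFinset, ∑ g ∈ incrPerms n (bodyWord t), f t g := by
  rw [← Finset.sum_product', Finset.sum_sigma']
  refine Finset.sum_bij (fun ab _ => ⟨templateOf n p q ab.2, ab.1 * ab.2⟩) ?_ ?_ ?_ ?_
  · rintro ⟨a, b⟩ hab
    rw [Finset.mem_product, mem_incrPerms, mem_incrPerms] at hab
    rw [Finset.mem_sigma, Set.Finite.mem_toFinset, mem_incrPerms]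
    exact ⟨templateOf_mem hp hq hab.2.1 hab.2.2, mul_mem hab.1.1 hab.2.1,
      incrOnFibers_mul hp hq hab.1.2 hab.2.1 hab.2.2⟩
  · rintro ⟨a, b⟩ hab ⟨a', b'⟩ hab' h
    rw [Finset.mem_product, mem_incrPerms, mem_incrPerms] at hab hab'
    rw [Sigma.mk.injEq, heq_eq_eq] at h
    obtain ⟨h1, h2⟩ := factorization_unique hp hq hab.1.2 hab.2.1 hab.2.2 hab'.1.2 hab'.2.1
      hab'.2.2 h.1 h.2
    exact Prod.ext h1 h2
  · rintro ⟨t, g⟩ h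
    rw [Finset.mem_sigma, Set.Finite.mem_toFinset, mem_incrPerms] at h
    obtain ⟨a, b, h1, h2, h3, h4, h5, h6⟩ := exists_factorization hp hq h.1 h.2.1 h.2.2
    exact ⟨(a, b), by simp [mem_incrPerms, h1, h2, h3, h4], by rw [h5, h6]⟩
  · intro ab _
    rfl

/-! ### The sign of a signed permutation -/

theorem prod_univ_pos {n : ℕ} {M : Type*} [CommMonoid M] (f : Fin (n + n) → M) :
    ∏ x, f x = (∏ x : Fin n, f (pos x)) * ∏ x : Fin n, f (pos x).rev := by
  have := sum_univ_pos (M := Additive M) fun x => Additive.ofMul (f x)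
  exact this

theorem sign_eq_prod_of_mem_signedPerms {n : ℕ} {b : Equiv.Perm (Fin (n + n))}
    (hb : b ∈ signedPerms n) :
    Equiv.Perm.sign b = ∏ x : Fin n, if b (pos x).rev < b (pos x) then 1 else -1 := by
  rw [Equiv.Perm.sign_eq_prod_prod_Ioi]
  have hsplit : ∀ i : Fin (n + n), (∏ j ∈ Finset.Ioi i, (if b i < b j then 1 else -1 : ℤˣ)) =
      (∏ j ∈ (Finset.Ioi i).filter (fun j => j ≠ i.rev), if b i < b j then 1 else -1) *
        if i < i.rev then (if b i < b i.rev then 1 else -1) else 1 := by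
    intro i
    rw [← Finset.prod_filter_mul_prod_filter_not (Finset.Ioi i) (fun j => j ≠ i.rev)]
    congr 1
    simp only [not_not, Finset.filter_eq', Finset.mem_Ioi]
    split_ifs <;> simp [*]
  rw [Finset.prod_congr rfl fun i _ => hsplit i, Finset.prod_mul_distrib]
  have h1 : (∏ i, ∏ j ∈ (Finset.Ioi i).filter (fun j => j ≠ i.rev),
      (if b i < b j then 1 else -1 : ℤˣ)) = 1 := by
    rw [Finset.prod_sigma']
    refine Finset.prod_involution (fun a _ => ⟨a.2.rev, a.1.rev⟩) ?_ ?_ ?_ ?_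
    · rintro ⟨i, j⟩ h
      simp only [hb i, hb j, Fin.rev_lt_rev]
      split_ifs <;> simp
    · rintro ⟨i, j⟩ h - h'
      simp only [Finset.mem_sigma, Finset.mem_filter] at h
      rw [Sigma.mk.injEq] at h'
      exact h.2.2 (by rw [← h'.1, Fin.rev_rev])
    · rintro ⟨i, j⟩ h
      simp only [Finset.mem_sigma, Finset.mem_univ, Finset.mem_filter, Finset.mem_Ioi, true_and,
        Fin.rev_lt_rev, Fin.rev_rev] at h ⊢
      exact ⟨h.1, fun h' => h.2 h'.symm⟩
    · rintro ⟨i, j⟩ h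
      simp
  rw [h1, one_mul, prod_univ_pos]
  have h2 : ∀ x : Fin n, ¬ pos x < (pos x).rev := fun x => (rev_pos_lt_pos x x).not_gt
  simp [h2, rev_pos_lt_pos]

theorem ySum_eq_of_letterCount {n u v : ℕ} {k : Fin n → ℕ ×ₗ ℤ} (hk : IsLetterFn u v k) {t : FT}
    (hu : t.u = u) (hv : t.v = v) (ht : ∀ c, letterCount t c = fiberCard k c) :
    ySum t = ∑ x, if (ofLex (k x)).2 < 0 then 1 else 0 := by
  have h1 : ∀ i ∈ Finset.Icc 1 u, ∑ j ∈ Finset.Icc 1 v, t.y i j =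
      ∑ j ∈ Finset.Icc 1 v, ∑ x, if (ofLex (k x)).1 = i then
        (if (ofLex (k x)).2.natAbs = j then (if (ofLex (k x)).2 < 0 then 1 else 0) else 0)
          else 0 := by
    intro i _
    refine Finset.sum_congr rfl fun j hj => ?_
    rw [Finset.mem_Icc] at hj
    rw [← letterCount_neg t i hj.1, ht, fiberCard_eq_sum]
    refine Finset.sum_congr rfl fun x _ => ?_
    simp only [lex_eq_iff]
    split_ifs <;> omega
  rw [ySum, hu, hv, Finset.sum_congr rfl h1]
  simp only [Finset.sum_comm (t := Finset.univ)]
  refine Finset.sum_congr rfl fun x _ => ?_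
  have := hk x
  by_cases h : (ofLex (k x)).2 < 0
  · have h3 : (ofLex (k x)).2.natAbs ∈ Finset.Icc 1 v := by rw [Finset.mem_Icc]; omega
    have h4 : (ofLex (k x)).1 ∈ Finset.Icc 1 u := by rw [Finset.mem_Icc]; omega
    simp only [h, if_true, Finset.sum_ite_irrel, Finset.sum_ite_eq, h3, h4, Finset.sum_const_zero]
  · simp [h]

theorem level_pos_of_sum_eq {n : ℕ} {p : List ℕ} (hp : p.sum = n) (x : Fin n) :
    0 < level n p x := by
  rw [lt_level_iff hp.le x.2]
  simp [hp]

theorem sign_eq_neg_one_pow_ySum {n : ℕ} {p q : List ℕ} (hp : p.sum = n)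
    {b : Equiv.Perm (Fin (n + n))} (hb : b ∈ signedPerms n)
    (hbq : IncrOnFibers (blockFn n q) b) :
    Equiv.Perm.sign b = (-1) ^ ySum (templateOf n p q b) := by
  have hk := isLetterFn_jointFn (p := p) hb hbq
  rw [sign_eq_prod_of_mem_signedPerms hb, templateOf,
    ySum_eq_of_letterCount hk rfl rfl (letterCount_countTemplate hk), ← Finset.prod_pow_eq_pow_sum]
  refine Finset.prod_congr rfl fun x _ => ?_
  have hj : (ofLex (jointFn n p q b x)).2 = blockFn n p (b (pos x)) := rfl
  obtain ⟨y, hy⟩ | ⟨y, hy⟩ := eq_pos_or_eq_rev_pos (b (pos x)) <;>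
    have hl := level_pos_of_sum_eq hp y <;> rw [hy] at hj
  · rw [hb, hy, if_pos (rev_pos_lt_pos y y), if_neg, pow_zero]
    rw [hj]; exact (blockFn_pos_nonneg p y).not_gt
  · rw [hb, hy, if_neg, if_pos, pow_one]
    · rw [hj, blockFn_rev, blockFn_pos]; omega
    · rw [Fin.rev_rev]; exact (rev_pos_lt_pos y y).not_gt

/-! ### The central transposition -/

/-- The transposition exchanging the two central points, that is, the integers `-1` and `1`. -/
def centralSwap {n : ℕ} (hn : 0 < n) : Equiv.Perm (Fin (n + n)) :=
  Equiv.swap (pos ⟨0, hn⟩) (pos ⟨0, hn⟩).rev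

/-- `w` is increasing on the fibres of `f`, except possibly on pairs of opposite points. -/
def IncrOffRev {n : ℕ} {α : Type*} (f : Fin (n + n) → α) (w : Equiv.Perm (Fin (n + n))) : Prop :=
  ∀ x y, x < y → y ≠ x.rev → f x = f y → w x < w y

section

variable {n : ℕ} (hn : 0 < n)

theorem centralSwap_apply (x : Fin (n + n)) :
    (centralSwap hn x : ℕ) = if (x : ℕ) = n then n - 1 else if (x : ℕ) = n - 1 then n else x := by
  rw [centralSwap, Equiv.swap_apply_def]
  have h1 : x = pos ⟨0, hn⟩ ↔ (x : ℕ) = n := by rw [Fin.ext_iff]; simp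
  have h2 : x = (pos ⟨0, hn⟩).rev ↔ (x : ℕ) = n - 1 := by
    rw [Fin.ext_iff, Fin.val_rev]; simp only [pos_val]; omega
  simp only [h1, h2]
  split_ifs
  · rw [Fin.val_rev]; simp only [pos_val]; omega
  · simp
  · rfl

@[simp] theorem centralSwap_mul_self : centralSwap hn * centralSwap hn = 1 :=
  Equiv.swap_mul_self _ _

@[simp] theorem mul_centralSwap_mul_centralSwap (w : Equiv.Perm (Fin (n + n))) :
    w * centralSwap hn * centralSwap hn = w := by rw [mul_assoc, centralSwap_mul_self, mul_one]

@[simp] theorem centralSwap_mul_centralSwap_mul (w : Equiv.Perm (Fin (n + n))) :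
    centralSwap hn * (centralSwap hn * w) = w := by rw [← mul_assoc, centralSwap_mul_self, one_mul]

theorem centralSwap_mem : centralSwap hn ∈ signedPerms n := by
  intro x
  ext
  rw [centralSwap_apply, Fin.val_rev, Fin.val_rev, centralSwap_apply]
  split_ifs <;> omega

theorem sign_centralSwap : Equiv.Perm.sign (centralSwap hn) = -1 :=
  Equiv.Perm.sign_swap (rev_pos_lt_pos _ _).ne'

theorem centralSwap_lt {x y : Fin (n + n)} (h : x < y) (h' : y ≠ x.rev) :
    centralSwap hn x < centralSwap hn y := by
  rw [Fin.lt_def] at h ⊢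
  rw [Ne, Fin.ext_iff, Fin.val_rev] at h'
  rw [centralSwap_apply, centralSwap_apply]
  split_ifs <;> omega

theorem ne_rev_apply {w : Equiv.Perm (Fin (n + n))} (hw : w ∈ signedPerms n)
    {x y : Fin (n + n)} (h : y ≠ x.rev) : w y ≠ (w x).rev := by
  rw [← hw]
  exact fun h' => h (w.injective h')

theorem IncrOffRev.centralSwap_mul {α : Type*} {f : Fin (n + n) → α}
    {w : Equiv.Perm (Fin (n + n))} (hw : w ∈ signedPerms n) (h : IncrOffRev f w) :
    IncrOffRev f (centralSwap hn * w) := fun x y hxy hne hf =>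
  centralSwap_lt hn (h x y hxy hne hf) (ne_rev_apply hw hne)

theorem level_zero_of_sum_lt {q : List ℕ} (hq : q.sum < n) : level n q 0 = 0 := by
  have := lt_level_iff (j := 0) hq.le (Nat.zero_lt_of_lt hq)
  simp at this
  omega

theorem blockFn_centralSwap {q : List ℕ} (hq : q.sum < n) (x : Fin (n + n)) :
    blockFn n q (centralSwap hn x) = blockFn n q x := by
  have h0 : blockFn n q (pos ⟨0, hn⟩) = 0 := by
    rw [blockFn_pos, level_zero_of_sum_lt hq]; rfl
  rw [centralSwap, Equiv.swap_apply_def]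
  split_ifs with h1 h2
  · rw [h1, blockFn_rev, h0, neg_zero]
  · rw [h2, blockFn_rev, h0, neg_zero]
  · rfl

theorem IncrOffRev.mul_centralSwap {q : List ℕ} (hq : q.sum < n)
    {w : Equiv.Perm (Fin (n + n))} (h : IncrOffRev (blockFn n q) w) :
    IncrOffRev (blockFn n q) (w * centralSwap hn) := fun x y hxy hne hf =>
  h _ _ (centralSwap_lt hn hxy hne) (ne_rev_apply (centralSwap_mem hn) hne)
    (by rw [blockFn_centralSwap hn hq, blockFn_centralSwap hn hq, hf])

theorem IncrOnFibers.incrOffRev {α : Type*} {f : Fin (n + n) → α}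
    {w : Equiv.Perm (Fin (n + n))} (h : IncrOnFibers f w) : IncrOffRev f w :=
  fun x y hxy _ => h x y hxy

theorem incrOffRev_iff_of_sum_eq {q : List ℕ} (hq : q.sum = n) {w : Equiv.Perm (Fin (n + n))} :
    IncrOffRev (blockFn n q) w ↔ IncrOnFibers (blockFn n q) w := by
  refine ⟨fun h x y hxy hf => h x y hxy ?_ hf, fun h => h.incrOffRev⟩
  rintro rfl
  obtain ⟨y, rfl⟩ | ⟨y, rfl⟩ := eq_pos_or_eq_rev_pos x <;>
  · have := level_pos_of_sum_eq hq y
    simp only [blockFn_rev, blockFn_pos] at hf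
    omega

theorem lt_rev_iff {x : Fin (n + n)} : x.rev < x ↔ ∃ y : Fin n, x = pos y := by
  constructor
  · intro h
    obtain h' | ⟨y, rfl⟩ := eq_pos_or_eq_rev_pos x
    · exact h'
    · rw [Fin.rev_rev] at h
      exact absurd h (rev_pos_lt_pos y y).not_gt
  · rintro ⟨y, rfl⟩
    exact rev_pos_lt_pos y y

theorem incrOnFibers_iff_incrOffRev {q : List ℕ} (hq : q.sum < n) {w : Equiv.Perm (Fin (n + n))}
    (hw : w ∈ signedPerms n) :
    IncrOnFibers (blockFn n q) w ↔
      IncrOffRev (blockFn n q) w ∧ (w (pos ⟨0, hn⟩)).rev < w (pos ⟨0, hn⟩) := by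
  have h0 : level n q (⟨0, hn⟩ : Fin n) = 0 := level_zero_of_sum_lt hq
  constructor
  · intro h
    refine ⟨h.incrOffRev, ?_⟩
    rw [← hw]
    exact h _ _ (rev_pos_lt_pos _ _) (by rw [blockFn_rev, blockFn_pos, h0]; rfl)
  · rintro ⟨h, hc⟩ x y hxy hf
    by_cases hne : y = x.rev
    · subst hne
      have hxy' : x.rev.rev < x.rev := by rwa [Fin.rev_rev]
      obtain ⟨y, hy⟩ := lt_rev_iff.1 hxy'
      rw [Fin.rev_eq_iff] at hy
      subst hy
      rw [Fin.rev_rev]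
      rw [Fin.rev_rev, blockFn_rev] at hf
      rw [hw]
      by_cases hy : y = ⟨0, hn⟩
      · rwa [hy]
      · have hlt : (⟨0, hn⟩ : Fin n) < y := by
          rw [Fin.lt_def]; rw [Fin.ext_iff] at hy; simp only at hy ⊢; omega
        have := h _ _ (pos_lt_pos.2 hlt) (by
          intro h'
          have := rev_pos_lt_pos (n := n) ⟨0, hn⟩ y
          rw [h'] at this
          exact lt_irrefl _ this) (by rw [blockFn_pos, h0]; push_cast; linarith)
        rw [lt_rev_iff] at hc ⊢
        obtain ⟨z, hz⟩ := hc
        obtain h1 | ⟨z', h1⟩ := eq_pos_or_eq_rev_pos (w (pos y))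
        · exact h1
        · rw [hz, h1] at this
          exact absurd this (rev_pos_lt_pos _ _).not_gt
    · exact h x y hxy hne hf

theorem level_cons_one {r : List ℕ} (hr : r.sum + 1 = n) (x : Fin n) :
    level n (1 :: r) x = level n r x + 1 := by
  have hs : (1 :: r).sum ≤ n := by simp; omega
  refine eq_of_forall_lt_iff fun j => ?_
  rw [lt_level_iff hs x.2]
  rcases j with _ | j
  · simp; omega
  · rw [add_lt_add_iff_right, lt_level_iff (by omega) x.2]
    simp only [psum, List.take_succ_cons, List.sum_cons]
    omega

theorem incrOffRev_iff_cons_one {r : List ℕ} (hr : r.sum + 1 = n)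
    {w : Equiv.Perm (Fin (n + n))} :
    IncrOffRev (blockFn n r) w ↔ IncrOnFibers (blockFn n (1 :: r)) w := by
  have hl : ∀ x : Fin n, level n r x = 0 → (x : ℕ) = 0 := by
    intro x hx
    have := lt_level_iff (q := r) (j := 0) (by omega) x.2
    simp only [psum_zero] at this
    omega
  refine forall₃_congr fun x y hxy => ?_
  suffices key : (y ≠ x.rev ∧ blockFn n r x = blockFn n r y) ↔
      blockFn n (1 :: r) x = blockFn n (1 :: r) y by
    rw [← key, and_imp]
  have hrev : ∀ x y : Fin n, pos x ≠ (pos y).rev := fun x y => (rev_pos_lt_pos y x).ne'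
  obtain ⟨x, rfl⟩ | ⟨x, rfl⟩ := eq_pos_or_eq_rev_pos x <;>
    obtain ⟨y, rfl⟩ | ⟨y, rfl⟩ := eq_pos_or_eq_rev_pos y <;>
    simp only [blockFn_rev, blockFn_pos, Fin.rev_rev, level_cons_one hr]
  · have := hrev y x
    simp only [this, ne_eq, not_false_eq_true, true_and]
    omega
  · exact absurd hxy (rev_pos_lt_pos y x).not_gt
  · refine iff_of_false ?_ (by omega)
    rintro ⟨h1, h2⟩
    have hx := hl x (by omega)
    have hy := hl y (by omega)
    exact h1 (congrArg pos (Fin.ext (by omega)))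
  · have := hrev x y
    simp only [this.symm, ne_eq, not_false_eq_true, true_and]
    omega

end

/-! ### Products of signed sums -/

section

variable {n : ℕ} {R : Type*} [Ring R] (θ : Equiv.Perm (Fin (n + n)) →* R)

/-- The sum of the signed permutations of sign `ε` increasing on the blocks of `q`. -/
noncomputable def incrSum (q : List ℕ) (ε : ℤˣ) : R :=
  ∑ w ∈ incrPerms n q, if Equiv.Perm.sign w = ε then θ w else 0

/-- The signed permutations increasing on the blocks of `q` off the opposite pairs. -/
noncomputable def offRevPerms (n : ℕ) (q : List ℕ) : Finset (Equiv.Perm (Fin (n + n))) :=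
  Finset.univ.filter fun w => w ∈ signedPerms n ∧ IncrOffRev (blockFn n q) w

theorem mem_offRevPerms {q : List ℕ} {w : Equiv.Perm (Fin (n + n))} :
    w ∈ offRevPerms n q ↔ w ∈ signedPerms n ∧ IncrOffRev (blockFn n q) w := by
  simp [offRevPerms]

/-- The sum of the signed permutations of sign `ε` increasing on the blocks of `q` off the
opposite pairs. -/
noncomputable def offRevSum (q : List ℕ) (ε : ℤˣ) : R :=
  ∑ w ∈ offRevPerms n q, if Equiv.Perm.sign w = ε then θ w else 0

theorem offRevSum_of_sum_eq {q : List ℕ} (hq : q.sum = n) (ε : ℤˣ) :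
    offRevSum θ q ε = incrSum θ q ε := by
  rw [offRevSum, incrSum]
  refine Finset.sum_congr ?_ fun _ _ => rfl
  ext w
  rw [mem_offRevPerms, mem_incrPerms, incrOffRev_iff_of_sum_eq hq]

theorem incrSum_cons_one {r : List ℕ} (hr : r.sum + 1 = n) (ε : ℤˣ) :
    incrSum θ (1 :: r) ε = offRevSum θ r ε := by
  rw [offRevSum, incrSum]
  refine Finset.sum_congr ?_ fun _ _ => rfl
  ext w
  rw [mem_offRevPerms, mem_incrPerms, incrOffRev_iff_cons_one hr]

theorem centralSwap_mul_offRevSum (hn : 0 < n) (q : List ℕ) (ε : ℤˣ) :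
    θ (centralSwap hn) * offRevSum θ q ε = offRevSum θ q (-ε) := by
  rw [offRevSum, offRevSum, Finset.mul_sum]
  refine Finset.sum_nbij' (centralSwap hn * ·) (centralSwap hn * ·) ?_ ?_ ?_ ?_ ?_
  · intro w hw
    rw [mem_offRevPerms] at hw ⊢
    exact ⟨mul_mem (centralSwap_mem hn) hw.1, hw.2.centralSwap_mul hn hw.1⟩
  · intro w hw
    rw [mem_offRevPerms] at hw ⊢
    exact ⟨mul_mem (centralSwap_mem hn) hw.1, hw.2.centralSwap_mul hn hw.1⟩
  · simp
  · simp
  · intro w _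
    simp only [mul_ite, mul_zero, map_mul, sign_centralSwap, neg_one_mul,
      neg_inj]

theorem offRevSum_mul_centralSwap (hn : 0 < n) {q : List ℕ} (hq : q.sum < n) (ε : ℤˣ) :
    offRevSum θ q ε * θ (centralSwap hn) = offRevSum θ q (-ε) := by
  rw [offRevSum, offRevSum, Finset.sum_mul]
  refine Finset.sum_nbij' (· * centralSwap hn) (· * centralSwap hn) ?_ ?_ ?_ ?_ ?_
  · intro w hw
    rw [mem_offRevPerms] at hw ⊢
    exact ⟨mul_mem hw.1 (centralSwap_mem hn), hw.2.mul_centralSwap hn hq⟩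
  · intro w hw
    rw [mem_offRevPerms] at hw ⊢
    exact ⟨mul_mem hw.1 (centralSwap_mem hn), hw.2.mul_centralSwap hn hq⟩
  · simp
  · simp
  · intro w _
    simp only [ite_mul, zero_mul, map_mul, sign_centralSwap, mul_neg_one,
      neg_inj]

theorem offRevSum_of_sum_lt (hn : 0 < n) {q : List ℕ} (hq : q.sum < n) (ε : ℤˣ) :
    offRevSum θ q ε = incrSum θ q ε + incrSum θ q (-ε) * θ (centralSwap hn) := by
  have hc : ∀ w ∈ signedPerms n, (w * centralSwap hn) (pos ⟨0, hn⟩) = (w (pos ⟨0, hn⟩)).rev := by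
    intro w hw
    rw [← hw, Equiv.Perm.mul_apply, centralSwap, Equiv.swap_apply_left]
  rw [offRevSum, ← Finset.sum_filter_add_sum_filter_not _
    fun w => (w (pos ⟨0, hn⟩)).rev < w (pos ⟨0, hn⟩)]
  congr 1
  · rw [incrSum]
    refine Finset.sum_congr ?_ fun _ _ => rfl
    ext w
    rw [Finset.mem_filter, mem_offRevPerms, mem_incrPerms, and_assoc]
    exact and_congr_right fun hw => (incrOnFibers_iff_incrOffRev hn hq hw).symm
  · rw [incrSum, Finset.sum_mul]
    refine Finset.sum_nbij' (· * centralSwap hn) (· * centralSwap hn) ?_ ?_ ?_ ?_ ?_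
    · intro w hw
      rw [Finset.mem_filter, mem_offRevPerms] at hw
      rw [mem_incrPerms]
      have hs := mul_mem hw.1.1 (centralSwap_mem hn)
      refine ⟨hs, (incrOnFibers_iff_incrOffRev hn hq hs).2 ⟨hw.1.2.mul_centralSwap hn hq, ?_⟩⟩
      rw [hc w hw.1.1, Fin.rev_rev]
      obtain ⟨y, hy⟩ | ⟨y, hy⟩ := eq_pos_or_eq_rev_pos (w (pos ⟨0, hn⟩))
      · exact absurd (rev_pos_lt_pos y y) (hy ▸ hw.2)
      · rw [hy, Fin.rev_rev]; exact rev_pos_lt_pos y y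
    · intro w hw
      rw [mem_incrPerms] at hw
      rw [Finset.mem_filter, mem_offRevPerms]
      have h := (incrOnFibers_iff_incrOffRev hn hq hw.1).1 hw.2
      refine ⟨⟨mul_mem hw.1 (centralSwap_mem hn), h.1.mul_centralSwap hn hq⟩, ?_⟩
      rw [hc w hw.1, Fin.rev_rev]
      exact h.2.not_gt
    · simp
    · simp
    · intro w _
      simp only [Equiv.Perm.sign_mul, sign_centralSwap, mul_neg_one, neg_inj, ite_mul, zero_mul,
        ← map_mul, mul_centralSwap_mul_centralSwap]

/-- The templates of `marginTemplates` as a finset. -/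
noncomputable def marginFinset {p q : List ℕ} (hp : p.sum ≤ n) (hq : q.sum ≤ n) : Finset FT :=
  (marginTemplates_finite hp hq).toFinset

theorem mem_marginFinset {p q : List ℕ} {hp : p.sum ≤ n} {hq : q.sum ≤ n} {t : FT} :
    t ∈ marginFinset hp hq ↔ t ∈ marginTemplates n p q :=
  Set.Finite.mem_toFinset _

theorem incrSum_mul_incrSum {p q : List ℕ} (hp : p.sum = n) (hq : q.sum ≤ n) (ε δ : ℤˣ) :
    incrSum θ p ε * incrSum θ q δ = ∑ t ∈ marginFinset hp.le hq,
      if (-1) ^ ySum t = δ then incrSum θ (bodyWord t) (ε * δ) else 0 := by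
  have h := sum_incrPerms_product hp.le hq fun t g =>
    if (-1) ^ ySum t = δ then (if Equiv.Perm.sign g = ε * δ then θ g else 0) else 0
  simp only [incrSum, Finset.sum_mul_sum]
  convert h using 2 with a ha t ht
  · refine Finset.sum_congr rfl fun b hb => ?_
    rw [mem_incrPerms] at hb
    rw [← sign_eq_neg_one_pow_ySum hp hb.1 hb.2, Equiv.Perm.sign_mul, map_mul]
    by_cases hδ : Equiv.Perm.sign b = δ
    · simp only [hδ, if_true, mul_left_inj, ite_mul, zero_mul]
    · rw [if_neg hδ, if_neg hδ, mul_zero]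
  · rfl
  · split_ifs <;> simp

theorem incrSum_mul_incrSum_add {p q : List ℕ} (hp : p.sum ≤ n) (hq : q.sum ≤ n) (ε : ℤˣ) :
    incrSum θ p ε * incrSum θ q 1 + incrSum θ p (-ε) * incrSum θ q (-1) =
      ∑ t ∈ marginFinset hp hq, incrSum θ (bodyWord t) ε := by
  have h := sum_incrPerms_product hp hq fun _ g => if Equiv.Perm.sign g = ε then θ g else 0
  rw [marginFinset]
  simp only [incrSum]
  rw [← h]
  simp only [Finset.sum_mul_sum, ← Finset.sum_add_distrib]
  refine Finset.sum_congr rfl fun a _ => Finset.sum_congr rfl fun b _ => ?_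
  rw [Equiv.Perm.sign_mul, map_mul]
  rcases Int.units_eq_one_or (Equiv.Perm.sign b) with hb | hb <;>
    simp [hb, neg_eq_iff_eq_neg]

end

/-! ### Simple reflections and inversions -/

/-- The smaller point of the pair of points exchanged by the `j`-th simple reflection. -/
def simpleLow {n : ℕ} (j : Fin n) : Fin (n + n) :=
  ⟨if (j : ℕ) = 0 then n - 2 else n + j - 1, by split_ifs <;> omega⟩

/-- The `j`-th simple reflection, as a permutation of `Fin (n + n)`. -/
def simpleRefl {n : ℕ} (j : Fin n) : Equiv.Perm (Fin (n + n)) :=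
  Equiv.swap (simpleLow j) (pos j) * Equiv.swap (simpleLow j).rev (pos j).rev

/-- The signed permutations which are even as permutations of `Fin (n + n)`. -/
def evenSignedPerms (n : ℕ) : Subgroup (Equiv.Perm (Fin (n + n))) :=
  signedPerms n ⊓ Equiv.Perm.sign.ker

theorem mem_evenSignedPerms {n : ℕ} {w : Equiv.Perm (Fin (n + n))} :
    w ∈ evenSignedPerms n ↔ w ∈ signedPerms n ∧ Equiv.Perm.sign w = 1 := Iff.rfl

/-- Inversions of `w`, not counting pairs of opposite points. -/
def invPairs {n : ℕ} (w : Equiv.Perm (Fin (n + n))) : Finset (Fin (n + n) × Fin (n + n)) :=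
  Finset.univ.filter fun a => a.1 < a.2 ∧ a.2 ≠ a.1.rev ∧ w a.2 < w a.1

theorem mem_invPairs {n : ℕ} {w : Equiv.Perm (Fin (n + n))} {a : Fin (n + n) × Fin (n + n)} :
    a ∈ invPairs w ↔ a.1 < a.2 ∧ a.2 ≠ a.1.rev ∧ w a.2 < w a.1 := by
  simp [invPairs]

/-- Weak monotonicity on all pairs of points which are not opposite. -/
def MonoOffRev {n : ℕ} (f : Fin (n + n) → ℤ) : Prop :=
  ∀ x y, x < y → y ≠ x.rev → f x ≤ f y

section

variable {n : ℕ} (hn : 2 ≤ n)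
include hn

theorem simpleRefl_apply (j : Fin n) (x : Fin (n + n)) :
    simpleRefl j x = if x = simpleLow j then pos j else if x = pos j then simpleLow j
      else if x = (simpleLow j).rev then (pos j).rev
      else if x = (pos j).rev then (simpleLow j).rev else x := by
  simp only [simpleRefl, Equiv.Perm.mul_apply, Equiv.swap_apply_def]
  simp only [Fin.ext_iff, apply_ite Fin.val, Fin.val_rev, pos_val, simpleLow]
  have := j.2
  split_ifs <;> omega

theorem simpleLow_lt (j : Fin n) : simpleLow j < pos j := by
  rw [Fin.lt_def]
  simp only [simpleLow, pos_val]
  split_ifs <;> omega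

theorem pos_ne_rev_simpleLow (j : Fin n) : pos j ≠ (simpleLow j).rev := by
  rw [Ne, Fin.ext_iff, Fin.val_rev]
  simp only [simpleLow, pos_val]
  split_ifs <;> omega

theorem simpleRefl_low (j : Fin n) : simpleRefl j (simpleLow j) = pos j := by
  rw [simpleRefl_apply hn, if_pos rfl]

theorem simpleRefl_pos (j : Fin n) : simpleRefl j (pos j) = simpleLow j := by
  rw [simpleRefl_apply hn, if_neg (simpleLow_lt hn j).ne', if_pos rfl]

theorem simpleRefl_mul_self (j : Fin n) : simpleRefl j * simpleRefl j = 1 := by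
  ext x
  rw [Equiv.Perm.mul_apply, simpleRefl_apply hn, simpleRefl_apply hn j x]
  simp only [Fin.ext_iff, apply_ite Fin.val, Fin.val_rev, pos_val, simpleLow, Equiv.Perm.one_apply]
  have := j.2
  split_ifs <;> omega

theorem simpleRefl_simpleRefl (j : Fin n) (x : Fin (n + n)) :
    simpleRefl j (simpleRefl j x) = x := by
  rw [← Equiv.Perm.mul_apply, simpleRefl_mul_self hn]; rfl

theorem simpleRefl_mem (j : Fin n) : simpleRefl j ∈ evenSignedPerms n := by
  rw [mem_evenSignedPerms]
  constructor
  · intro x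
    rw [simpleRefl_apply hn, simpleRefl_apply hn]
    simp only [Fin.ext_iff, apply_ite Fin.val, apply_ite Fin.rev, Fin.val_rev, pos_val, simpleLow]
    have := j.2
    have := x.2
    split_ifs <;> omega
  · rw [simpleRefl, Equiv.Perm.sign_mul, Equiv.Perm.sign_swap (simpleLow_lt hn j).ne,
      Equiv.Perm.sign_swap (Fin.rev_injective.ne (simpleLow_lt hn j).ne)]
    rfl

theorem simpleRefl_lt (j : Fin n) {x y : Fin (n + n)} (h : x < y) (h' : y ≠ x.rev)
    (h1 : ¬ (x = simpleLow j ∧ y = pos j)) (h2 : ¬ (x = (pos j).rev ∧ y = (simpleLow j).rev)) :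
    simpleRefl j x < simpleRefl j y := by
  rw [simpleRefl_apply hn, simpleRefl_apply hn]
  rw [Fin.lt_def] at h ⊢
  simp only [Ne, Fin.ext_iff, apply_ite Fin.val, Fin.val_rev, pos_val, simpleLow] at *
  have := j.2
  split_ifs at * <;> omega

theorem card_invPairs_of_descent {w : Equiv.Perm (Fin (n + n))} (hw : w ∈ signedPerms n)
    {j : Fin n} (hj : w (pos j) < w (simpleLow j)) :
    (invPairs w).card = (invPairs (w * simpleRefl j)).card + 2 := by
  set s := simpleRefl j with hs
  set a : Fin (n + n) × Fin (n + n) := (simpleLow j, pos j) with ha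
  set b : Fin (n + n) × Fin (n + n) := ((pos j).rev, (simpleLow j).rev) with hb
  have hsm : s ∈ signedPerms n := (mem_evenSignedPerms.1 (simpleRefl_mem hn j)).1
  have hab : a ≠ b := by
    intro h
    have := congrArg Prod.snd h
    exact pos_ne_rev_simpleLow hn j this
  have hsub : {a, b} ⊆ invPairs w := by
    intro c hc
    rw [Finset.mem_insert, Finset.mem_singleton] at hc
    rw [mem_invPairs]
    rcases hc with rfl | rfl
    · exact ⟨simpleLow_lt hn j, pos_ne_rev_simpleLow hn j, hj⟩
    · refine ⟨Fin.rev_lt_rev.2 (simpleLow_lt hn j), ?_, ?_⟩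
      · simp only [Fin.rev_rev, hb]
        exact fun h => pos_ne_rev_simpleLow hn j h.symm
      · simp only [hb]
        rw [hw, hw]
        exact Fin.rev_lt_rev.2 hj
  have hcard : (invPairs (w * s)).card = (invPairs w \ {a, b}).card := by
    refine Finset.card_bij' (fun c _ => (s c.1, s c.2)) (fun c _ => (s c.1, s c.2)) ?_ ?_ ?_ ?_
    · intro c hc
      rw [mem_invPairs] at hc
      obtain ⟨h1, h2, h3⟩ := hc
      have hne : c ≠ a ∧ c ≠ b := by
        constructor
        · rintro rfl
          simp only [ha, Equiv.Perm.mul_apply, hs, simpleRefl_pos hn, simpleRefl_low hn] at h3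
          exact lt_asymm h3 hj
        · rintro rfl
          simp only [hb, Equiv.Perm.mul_apply] at h3
          rw [hsm, hsm, hw, hw, Fin.rev_lt_rev] at h3
          simp only [hs, simpleRefl_pos hn, simpleRefl_low hn] at h3
          exact lt_asymm h3 hj
      have hlt : s c.1 < s c.2 := by
        refine simpleRefl_lt hn j h1 h2 ?_ ?_
        · rintro ⟨h, h'⟩; exact hne.1 (Prod.ext h h')
        · rintro ⟨h, h'⟩; exact hne.2 (Prod.ext h h')
      rw [Finset.mem_sdiff, mem_invPairs, Finset.mem_insert, Finset.mem_singleton]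
      refine ⟨⟨hlt, ne_rev_apply hsm h2, h3⟩, ?_⟩
      rintro (h | h)
      · have e1 : s c.1 = simpleLow j := congrArg Prod.fst h
        have e2 : s c.2 = pos j := congrArg Prod.snd h
        have e1' : c.1 = pos j := by
          rw [← simpleRefl_simpleRefl hn j c.1, ← hs, e1]; exact simpleRefl_low hn j
        have e2' : c.2 = simpleLow j := by
          rw [← simpleRefl_simpleRefl hn j c.2, ← hs, e2]; exact simpleRefl_pos hn j
        rw [e1', e2'] at h1
        exact lt_asymm h1 (simpleLow_lt hn j)
      · have e1 : s c.1 = (pos j).rev := congrArg Prod.fst h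
        have e2 : s c.2 = (simpleLow j).rev := congrArg Prod.snd h
        have e1' : c.1 = (simpleLow j).rev := by
          rw [← simpleRefl_simpleRefl hn j c.1, ← hs, e1, hsm]
          exact congrArg Fin.rev (simpleRefl_pos hn j)
        have e2' : c.2 = (pos j).rev := by
          rw [← simpleRefl_simpleRefl hn j c.2, ← hs, e2, hsm]
          exact congrArg Fin.rev (simpleRefl_low hn j)
        rw [e1', e2', Fin.rev_lt_rev] at h1
        exact lt_asymm h1 (simpleLow_lt hn j)
    · intro c hc
      rw [Finset.mem_sdiff, mem_invPairs, Finset.mem_insert, Finset.mem_singleton, not_or] at hc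
      obtain ⟨⟨h1, h2, h3⟩, hne⟩ := hc
      rw [mem_invPairs]
      refine ⟨simpleRefl_lt hn j h1 h2 ?_ ?_, ne_rev_apply hsm h2, ?_⟩
      · rintro ⟨h, h'⟩; exact hne.1 (Prod.ext h h')
      · rintro ⟨h, h'⟩; exact hne.2 (Prod.ext h h')
      · simpa only [Equiv.Perm.mul_apply, hs, simpleRefl_simpleRefl hn] using h3
    · intro c _
      simp only [hs, simpleRefl_simpleRefl hn]
    · intro c _
      simp only [hs, simpleRefl_simpleRefl hn]
  rw [hcard, Finset.card_sdiff_of_subset hsub, Finset.card_pair hab]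
  have := Finset.card_le_card hsub
  rw [Finset.card_pair hab] at this
  omega

theorem card_invPairs_mul_le {w : Equiv.Perm (Fin (n + n))} (hw : w ∈ signedPerms n) (j : Fin n) :
    (invPairs (w * simpleRefl j)).card ≤ (invPairs w).card + 2 := by
  by_cases h : w (pos j) < w (simpleLow j)
  · have := card_invPairs_of_descent hn hw h
    omega
  · have hlt : w (simpleLow j) < w (pos j) :=
      lt_of_le_of_ne (not_lt.1 h) (w.injective.ne (simpleLow_lt hn j).ne)
    have := card_invPairs_of_descent hn (j := j) (w := w * simpleRefl j)
      ((signedPerms n).mul_mem hw (mem_evenSignedPerms.1 (simpleRefl_mem hn j)).1)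
      (by simpa only [Equiv.Perm.mul_apply, simpleRefl_pos hn, simpleRefl_low hn] using hlt)
    rw [mul_assoc, simpleRefl_mul_self hn, mul_one] at this
    omega

theorem incrOffRev_iff_simple {f : Fin (n + n) → ℤ} (hodd : ∀ x, f x.rev = -f x)
    (hf : MonoOffRev f) {w : Equiv.Perm (Fin (n + n))} (hw : w ∈ signedPerms n) :
    IncrOffRev f w ↔ ∀ j : Fin n, f (simpleLow j) = f (pos j) → w (simpleLow j) < w (pos j) := by
  refine ⟨fun h j => h _ _ (simpleLow_lt hn j) (pos_ne_rev_simpleLow hn j), fun h => ?_⟩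
  have hrev : ∀ j : Fin n, f (pos j).rev = f (simpleLow j).rev →
      w (pos j).rev < w (simpleLow j).rev := by
    intro j hj
    rw [hodd, hodd] at hj
    rw [hw, hw, Fin.rev_lt_rev]
    exact h j (by linarith)
  suffices H : ∀ d, ∀ x y : Fin (n + n), (y : ℕ) - x ≤ d → x < y → y ≠ x.rev → f x = f y →
      w x < w y from fun x y => H _ x y le_rfl
  intro d
  induction d with
  | zero => intro x y hd hxy; rw [Fin.lt_def] at hxy; omega
  | succ d ih =>
    intro x y hd hxy hne hfe
    by_cases hz : ∃ z : Fin (n + n), x < z ∧ z < y ∧ z ≠ x.rev ∧ y ≠ z.rev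
    · obtain ⟨z, h1, h2, h3, h4⟩ := hz
      have e1 := hf _ _ h1 h3
      have e2 := hf _ _ h2 h4
      rw [Fin.lt_def] at h1 h2
      exact (ih x z (by omega) h1 h3 (by omega)).trans (ih z y (by omega) h2 h4 (by omega))
    · have hz1 : ∀ z : ℕ, z < n + n → ¬ ((x : ℕ) < z ∧ z < y ∧ z ≠ n + n - (x + 1) ∧
          (y : ℕ) ≠ n + n - (z + 1)) := by
        rintro z hzn ⟨h1, h2, h3, h4⟩
        refine hz ⟨⟨z, hzn⟩, h1, h2, ?_, ?_⟩
        · rw [Ne, Fin.ext_iff, Fin.val_rev]; exact h3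
        · rw [Ne, Fin.ext_iff, Fin.val_rev]; exact h4
      rw [Fin.lt_def] at hxy
      rw [Ne, Fin.ext_iff, Fin.val_rev] at hne
      have hx := x.2
      have hy := y.2
      have a1 := hz1 (x + 1)
      have a2 := hz1 (x + 2)
      by_cases hyn : (n : ℕ) ≤ y ∧ n - 1 ≠ x ∧ n - 2 ≤ (x : ℕ)
      · obtain ⟨j, rfl, rfl⟩ : ∃ j : Fin n, x = simpleLow j ∧ y = pos j := by
          refine ⟨⟨y - n, by omega⟩, ?_, ?_⟩
          · rw [Fin.ext_iff]
            simp only [simpleLow]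
            split_ifs <;> omega
          · rw [Fin.ext_iff, pos_val]
            simp only
            omega
        exact h _ hfe
      · obtain ⟨j, rfl, rfl⟩ : ∃ j : Fin n, x = (pos j).rev ∧ y = (simpleLow j).rev := by
          refine ⟨⟨n - 1 - x, by omega⟩, ?_, ?_⟩
          · rw [Fin.ext_iff, Fin.val_rev, pos_val]
            simp only
            omega
          · rw [Fin.ext_iff, Fin.val_rev]
            simp only [simpleLow]
            split_ifs <;> omega
        exact hrev _ hfe

theorem eq_one_of_incrOffRev {u : Equiv.Perm (Fin (n + n))} (hu : u ∈ evenSignedPerms n)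
    (h : ∀ x y, x < y → y ≠ x.rev → u x < u y) : u = 1 := by
  have hn0 : 0 < n := by omega
  have hs : ([] : List ℕ).sum < n := hn0
  have hb : ∀ x, blockFn n [] x = 0 := fun x => by
    have hl : ∀ y, level n [] y = 0 := fun y => Nat.le_zero.1 (level_le n [] y)
    obtain ⟨y, rfl⟩ | ⟨y, rfl⟩ := eq_pos_or_eq_rev_pos x
    · simp [hl]
    · simp [blockFn_rev, hl]
  have key : ∀ w : Equiv.Perm (Fin (n + n)), IncrOnFibers (blockFn n []) w → w = 1 := by
    intro w hw
    have h1 : IncrOnFibers (blockFn n []) 1 := fun x y hxy _ => hxy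
    rw [hw.eq_sort (blockFn_monotone n []), h1.eq_sort (blockFn_monotone n [])]
    congr 1
    funext x
    simp [hb]
  have hu' : IncrOffRev (blockFn n []) u := fun x y hxy hne _ => h x y hxy hne
  rw [mem_evenSignedPerms] at hu
  by_cases hc : (u (pos ⟨0, hn0⟩)).rev < u (pos ⟨0, hn0⟩)
  · exact key u ((incrOnFibers_iff_incrOffRev hn0 hs hu.1).2 ⟨hu', hc⟩)
  · have h1 : u * centralSwap hn0 = 1 := by
      refine key _ ((incrOnFibers_iff_incrOffRev hn0 hs
        ((signedPerms n).mul_mem hu.1 (centralSwap_mem hn0))).2 ⟨hu'.mul_centralSwap hn0 hs, ?_⟩)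
      rw [Equiv.Perm.mul_apply, centralSwap, Equiv.swap_apply_left, hu.1, Fin.rev_rev]
      refine lt_of_le_of_ne (not_lt.1 hc) ?_
      rw [← hu.1]
      exact u.injective.ne (rev_pos_lt_pos _ _).ne'
    have h2 := congrArg Equiv.Perm.sign h1
    rw [Equiv.Perm.sign_mul, hu.2, sign_centralSwap, one_mul, Equiv.Perm.sign_one] at h2
    exact absurd h2 (by decide)

end

/-! ### Embedding the signed permutations, and the Coxeter length -/

/-- The points of `Fin (n + n)` in increasing order encode `-n, …, -1, 1, …, n`. -/
def toDom (n : ℕ) : Fin (n + n) ↪ Dom n where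
  toFun x := if n ≤ (x : ℕ) then (⟨x - n, by omega⟩, true) else (⟨n - 1 - x, by omega⟩, false)
  inj' x y h := by
    simp only at h
    rw [Fin.ext_iff]
    split_ifs at h <;> simp [Prod.ext_iff] at h <;> omega

/-- The embedding of permutations of `Fin (n + n)` into permutations of `Dom n`. -/
noncomputable def permDom (n : ℕ) : Equiv.Perm (Fin (n + n)) →* Equiv.Perm (Dom n) :=
  Equiv.Perm.viaEmbeddingHom (toDom n)

theorem permDom_injective (n : ℕ) : Function.Injective (permDom n) :=
  Equiv.Perm.viaEmbeddingHom_injective _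

theorem permDom_swap {n : ℕ} (a b : Fin (n + n)) :
    permDom n (Equiv.swap a b) = Equiv.swap (toDom n a) (toDom n b) := by
  ext1 x
  rw [permDom, Equiv.Perm.viaEmbeddingHom_apply]
  by_cases hx : x ∈ Set.range (toDom n)
  · obtain ⟨y, rfl⟩ := hx
    rw [Equiv.Perm.viaEmbedding_apply, (toDom n).injective.swap_apply]
  · rw [Equiv.Perm.viaEmbedding_apply_of_notMem _ _ _ hx, Equiv.swap_apply_of_ne_of_ne]
    · rintro rfl; exact hx ⟨_, rfl⟩
    · rintro rfl; exact hx ⟨_, rfl⟩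

theorem pt_eq_toDom {n : ℕ} {a : ℤ} {x : Fin (n + n)} (h0 : a ≠ 0)
    (hx : (x : ℤ) = if 0 < a then n + a - 1 else n + a) : pt n a = toDom n x := by
  have hxn := x.2
  change _ = if n ≤ (x : ℕ) then _ else _
  rw [pt]
  by_cases ha : 0 < a
  · rw [if_pos ha] at hx
    rw [if_pos (by omega), Prod.ext_iff, Fin.ext_iff]
    refine ⟨?_, decide_eq_true ha⟩
    simp only
    rw [Nat.mod_eq_of_lt (by omega)]
    omega
  · rw [if_neg ha] at hx
    rw [if_neg (by omega), Prod.ext_iff, Fin.ext_iff]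
    refine ⟨?_, decide_eq_false ha⟩
    simp only
    rw [Nat.mod_eq_of_lt (by omega)]
    omega

section

variable {n : ℕ} (hn : 2 ≤ n)
include hn

theorem simpleRefl_eq_swap_mul_swap (j : Fin n) :
    simpleRefl j = Equiv.swap (simpleLow j).rev (pos j).rev * Equiv.swap (simpleLow j) (pos j) := by
  rw [← inv_inj, ← mul_left_inj (simpleRefl j), inv_mul_cancel]
  simp only [mul_inv_rev, Equiv.swap_inv]
  exact (simpleRefl_mul_self hn j).symm

theorem gen_eq_permDom (j : Fin n) : gen n j = permDom n (simpleRefl j) := by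
  have hj := j.2
  by_cases h : (j : ℕ) = 0
  · rw [gen, if_pos h, simpleRefl, map_mul, permDom_swap, permDom_swap,
      Equiv.swap_comm (toDom n (simpleLow j).rev), swapD, swapD,
      pt_eq_toDom (a := -2) (x := simpleLow j), pt_eq_toDom (a := 1) (x := pos j),
      pt_eq_toDom (a := -1) (x := (pos j).rev), pt_eq_toDom (a := 2) (x := (simpleLow j).rev)]
    all_goals try simp only [simpleLow, Fin.val_rev, pos_val, h, if_true]
    all_goals omega
  · rw [gen, if_neg h, simpleRefl_eq_swap_mul_swap hn, map_mul, permDom_swap, permDom_swap,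
      Equiv.swap_comm (toDom n (simpleLow j).rev), swapD, swapD,
      pt_eq_toDom (a := -(j : ℤ) - 1) (x := (pos j).rev),
      pt_eq_toDom (a := -(j : ℤ)) (x := (simpleLow j).rev),
      pt_eq_toDom (a := (j : ℤ)) (x := simpleLow j),
      pt_eq_toDom (a := (j : ℤ) + 1) (x := pos j)]
    all_goals try simp only [simpleLow, Fin.val_rev, pos_val, h, if_false]
    all_goals omega

theorem exists_word {w : Equiv.Perm (Fin (n + n))} (hw : w ∈ evenSignedPerms n) :
    ∃ l : List ℕ, (∀ i ∈ l, i < n) ∧ 2 * l.length = (invPairs w).card ∧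
      (l.map (gen n)).prod = permDom n w := by
  induction hk : (invPairs w).card using Nat.strong_induction_on generalizing w with
  | _ k ih =>
    by_cases hd : ∃ j : Fin n, w (pos j) < w (simpleLow j)
    · obtain ⟨j, hj⟩ := hd
      have hc := card_invPairs_of_descent hn (mem_evenSignedPerms.1 hw).1 hj
      obtain ⟨l, hl, hlen, hprod⟩ := ih _ (by omega)
        ((evenSignedPerms n).mul_mem hw (simpleRefl_mem hn j)) rfl
      refine ⟨l ++ [(j : ℕ)], ?_, ?_, ?_⟩
      · intro i hi
        rw [List.mem_append, List.mem_singleton] at hi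
        rcases hi with hi | rfl
        · exact hl i hi
        · exact j.2
      · rw [List.length_append, List.length_singleton]
        omega
      · rw [List.map_append, List.prod_append, hprod, List.map_singleton, List.prod_singleton,
          gen_eq_permDom hn, ← map_mul, mul_assoc, simpleRefl_mul_self hn, mul_one]
    · push Not at hd
      have h1 : w = 1 := by
        refine eq_one_of_incrOffRev hn hw fun x y hxy hne => ?_
        refine (incrOffRev_iff_simple hn (f := fun _ => 0) (by simp) (fun _ _ _ _ => le_rfl)
          (mem_evenSignedPerms.1 hw).1).2 (fun j _ => ?_) x y hxy hne rfl
        exact lt_of_le_of_ne (hd j) (w.injective.ne (simpleLow_lt hn j).ne)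
      subst h1
      refine ⟨[], by simp, ?_, by simp⟩
      rw [← hk, eq_comm, List.length_nil, mul_zero, Finset.card_eq_zero, Finset.eq_empty_iff_forall_notMem]
      intro a ha
      rw [mem_invPairs] at ha
      exact lt_asymm ha.1 ha.2.2

theorem exists_of_word {l : List ℕ} (hl : ∀ i ∈ l, i < n) :
    ∃ w ∈ evenSignedPerms n, (invPairs w).card ≤ 2 * l.length ∧
      (l.map (gen n)).prod = permDom n w := by
  induction l using List.reverseRecOn with
  | nil =>
    refine ⟨1, (evenSignedPerms n).one_mem, ?_, by simp⟩
    rw [List.length_nil, mul_zero, Nat.le_zero, Finset.card_eq_zero,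
      Finset.eq_empty_iff_forall_notMem]
    intro a ha
    rw [mem_invPairs] at ha
    exact lt_asymm ha.1 ha.2.2
  | append_singleton l j ih =>
    obtain ⟨w, hw, hc, hp⟩ := ih fun i hi => hl i (by simp [hi])
    have hj : j < n := hl j (by simp)
    refine ⟨w * simpleRefl ⟨j, hj⟩, (evenSignedPerms n).mul_mem hw (simpleRefl_mem hn _), ?_, ?_⟩
    · have := card_invPairs_mul_le hn (mem_evenSignedPerms.1 hw).1 ⟨j, hj⟩
      rw [List.length_append, List.length_singleton]
      omega
    · rw [List.map_append, List.prod_append, hp, List.map_singleton, List.prod_singleton, map_mul,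
        ← gen_eq_permDom hn]

theorem two_mul_len {w : Equiv.Perm (Fin (n + n))} (hw : w ∈ evenSignedPerms n) :
    2 * len n (permDom n w) = (invPairs w).card := by
  obtain ⟨l, hl, hlen, hprod⟩ := exists_word hn hw
  refine le_antisymm ?_ ?_
  · rw [← hlen]
    exact Nat.mul_le_mul_left 2 (Nat.sInf_le ⟨l, hl, rfl, hprod⟩)
  · obtain ⟨l', hl', hlen', hprod'⟩ := Nat.sInf_mem (s := {k | ∃ l : List ℕ, (∀ i ∈ l, i < n) ∧
      l.length = k ∧ (l.map (gen n)).prod = permDom n w}) ⟨_, l, hl, rfl, hprod⟩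
    obtain ⟨w', _, hc, hp⟩ := exists_of_word hn hl'
    rw [hprod'] at hp
    obtain rfl := permDom_injective n hp
    rw [hlen'] at hc
    exact hc.trans_eq rfl

theorem Dgroup_eq : Dgroup n = (evenSignedPerms n).map (permDom n) := by
  apply le_antisymm
  · rw [Dgroup, Subgroup.closure_le]
    rintro _ ⟨j, hj, rfl⟩
    exact ⟨simpleRefl ⟨j, hj⟩, simpleRefl_mem hn _, (gen_eq_permDom hn ⟨j, hj⟩).symm⟩
  · rintro _ ⟨w, hw, rfl⟩
    obtain ⟨l, hl, -, hprod⟩ := exists_word hn hw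
    rw [← hprod]
    refine Subgroup.list_prod_mem _ fun x hx => ?_
    obtain ⟨i, hi, rfl⟩ := List.mem_map.1 hx
    exact Subgroup.subset_closure ⟨i, hl i hi, rfl⟩

theorem exists_of_mem_WJ {f : Fin (n + n) → ℤ} (hodd : ∀ x, f x.rev = -f x) {J : Set ℕ}
    (hJn : J ⊆ Set.Iio n) (hJ : ∀ j : Fin n, (j : ℕ) ∈ J → f (simpleLow j) = f (pos j))
    {u : Equiv.Perm (Dom n)} (hu : u ∈ WJ n J) :
    ∃ v ∈ evenSignedPerms n, (∀ x, f (v x) = f x) ∧ permDom n v = u := by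
  induction hu using Subgroup.closure_induction with
  | mem x hx =>
    obtain ⟨j, hj, rfl⟩ := hx
    have hjn : j < n := hJn hj
    refine ⟨simpleRefl ⟨j, hjn⟩, simpleRefl_mem hn _, fun x => ?_, (gen_eq_permDom hn ⟨j, hjn⟩).symm⟩
    have := hJ ⟨j, hjn⟩ hj
    rw [simpleRefl_apply hn]
    split_ifs with h1 h2 h3 h4
    · rw [h1, this]
    · rw [h2, this]
    · rw [h3, hodd, hodd, this]
    · rw [h4, hodd, hodd, this]
    · rfl
  | one => exact ⟨1, Subgroup.one_mem _, fun _ => rfl, map_one _⟩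
  | mul x y _ _ hx hy =>
    obtain ⟨v, hv, hf, rfl⟩ := hx
    obtain ⟨v', hv', hf', rfl⟩ := hy
    exact ⟨v * v', Subgroup.mul_mem _ hv hv', fun x => by rw [Equiv.Perm.mul_apply, hf, hf'],
      map_mul _ _ _⟩
  | inv x _ hx =>
    obtain ⟨v, hv, hf, rfl⟩ := hx
    exact ⟨v⁻¹, Subgroup.inv_mem _ hv, fun x => by
      rw [← hf (v⁻¹ x), show v (v⁻¹ x) = x from v.apply_symm_apply x], map_inv _ _⟩

theorem mem_X_iff {f : Fin (n + n) → ℤ} (hodd : ∀ x, f x.rev = -f x) (hf : MonoOffRev f)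
    {J : Set ℕ} (hJn : J ⊆ Set.Iio n)
    (hJ : ∀ j : Fin n, (j : ℕ) ∈ J ↔ f (simpleLow j) = f (pos j)) {x : Equiv.Perm (Dom n)} :
    x ∈ X n J ↔ ∃ w ∈ evenSignedPerms n, IncrOffRev f w ∧ permDom n w = x := by
  have hmp : ∀ w ∈ evenSignedPerms n, permDom n w ∈ X n J → IncrOffRev f w := by
    intro w hw hX
    rw [incrOffRev_iff_simple hn hodd hf (mem_evenSignedPerms.1 hw).1]
    intro j hj
    by_contra hlt
    have hlt' : w (pos j) < w (simpleLow j) :=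
      lt_of_le_of_ne (not_lt.1 hlt) (w.injective.ne (simpleLow_lt hn j).ne')
    have h1 := hX.2 _ (Subgroup.subset_closure ⟨j, (hJ j).2 hj, rfl⟩)
    rw [gen_eq_permDom hn, ← map_mul] at h1
    have h2 := two_mul_len hn hw
    have h3 := two_mul_len hn ((evenSignedPerms n).mul_mem hw (simpleRefl_mem hn j))
    have h4 := card_invPairs_of_descent hn (mem_evenSignedPerms.1 hw).1 hlt'
    omega
  constructor
  · intro hx
    have hx1 := hx.1
    rw [Dgroup_eq hn] at hx1
    obtain ⟨w, hw, rfl⟩ := hx1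
    exact ⟨w, hw, hmp w hw hx, rfl⟩
  · rintro ⟨w, hw, hinc, rfl⟩
    obtain ⟨⟨u, hu⟩, hmin⟩ := Finite.exists_min
      (fun u : WJ n J => len n (permDom n w * u))
    obtain ⟨v, hv, hfv, rfl⟩ := exists_of_mem_WJ hn hodd hJn (fun j hj => (hJ j).1 hj) hu
    simp only [← map_mul] at hmin
    have hwv := (evenSignedPerms n).mul_mem hw hv
    have hinc' : IncrOffRev f (w * v) := by
      refine hmp _ hwv ⟨?_, fun u' hu' => ?_⟩
      · rw [Dgroup_eq hn]
        exact ⟨_, hwv, rfl⟩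
      · have := hmin ⟨permDom n v * u', Subgroup.mul_mem _ hu hu'⟩
        rwa [← mul_assoc, ← map_mul] at this
    have hv1 : v = 1 := by
      refine eq_one_of_incrOffRev hn hv fun x y hxy hne => ?_
      by_contra hlt
      have hlt' : v y < v x := lt_of_le_of_ne (not_lt.1 hlt) (v.injective.ne hxy.ne')
      have hne' : v x ≠ (v y).rev := fun h =>
        ne_rev_apply (mem_evenSignedPerms.1 hv).1 hne (by rw [h, Fin.rev_rev])
      have h1 := hf _ _ hxy hne
      have h2 := hf _ _ hlt' hne'
      rw [hfv, hfv] at h2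
      have h3 := le_antisymm h1 h2
      have h4 := hinc' _ _ hxy hne h3
      have h5 := hinc _ _ hlt' hne' (by rw [hfv, hfv, h3])
      exact lt_asymm h4 h5
    subst hv1
    refine ⟨?_, fun u' hu' => ?_⟩
    · rw [Dgroup_eq hn]
      exact ⟨_, hw, rfl⟩
    · have := hmin ⟨u', hu'⟩
      rwa [mul_one] at this

end

/-! ### The basis elements as signed sums -/

/-- The embedding of permutations of `Fin (n + n)` into the group algebra. -/
noncomputable def ofPerm (n : ℕ) :
    Equiv.Perm (Fin (n + n)) →* MonoidAlgebra ℚ (Equiv.Perm (Dom n)) :=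
  (MonoidAlgebra.of ℚ (Equiv.Perm (Dom n))).comp (permDom n)

theorem ofPerm_apply {n : ℕ} (w : Equiv.Perm (Fin (n + n))) :
    ofPerm n w = MonoidAlgebra.of ℚ (Equiv.Perm (Dom n)) (permDom n w) := rfl

section

variable {n : ℕ} (hn : 2 ≤ n)
include hn

theorem XX_eq_sum {f : Fin (n + n) → ℤ} (hodd : ∀ x, f x.rev = -f x) (hf : MonoOffRev f)
    {J : Set ℕ} (hJn : J ⊆ Set.Iio n)
    (hJ : ∀ j : Fin n, (j : ℕ) ∈ J ↔ f (simpleLow j) = f (pos j)) :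
    XX n J = ∑ w with w ∈ signedPerms n ∧ IncrOffRev f w,
      if Equiv.Perm.sign w = 1 then ofPerm n w else 0 := by
  rw [XX, ← Finset.sum_filter, ← Finset.sum_filter, Finset.filter_filter, eq_comm]
  refine Finset.sum_nbij (permDom n) ?_ (permDom_injective n).injOn ?_ fun w _ => ofPerm_apply w
  · intro w hw
    simp only [Finset.mem_filter, Finset.mem_univ, true_and] at hw ⊢
    rw [mem_X_iff hn hodd hf hJn hJ]
    exact ⟨w, mem_evenSignedPerms.2 ⟨hw.1.1, hw.2⟩, hw.1.2, rfl⟩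
  · intro x hx
    simp only [Finset.coe_filter, Finset.mem_univ, true_and, Set.mem_ofPred_eq] at hx
    rw [mem_X_iff hn hodd hf hJn hJ] at hx
    obtain ⟨w, hw, hi, rfl⟩ := hx
    refine ⟨w, ?_, rfl⟩
    simp only [Finset.coe_filter, Finset.mem_univ, true_and, Set.mem_ofPred_eq]
    exact ⟨⟨hw.1, hi⟩, hw.2⟩

theorem simpleLow_of_eq_zero {j : Fin n} (hj : (j : ℕ) = 0) :
    simpleLow j = (pos ⟨1, hn⟩).rev := by
  rw [Fin.ext_iff, Fin.val_rev]
  simp only [simpleLow, pos_val, hj, if_true]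
  omega

omit hn in
theorem simpleLow_of_ne_zero {j : Fin n} (hj : (j : ℕ) ≠ 0) :
    simpleLow j = pos ⟨j - 1, by omega⟩ := by
  rw [Fin.ext_iff]
  simp only [simpleLow, pos_val, hj, if_false]
  omega

omit hn in
theorem level_pred_eq_iff {q : List ℕ} {j : ℕ} (hj : j ≠ 0) :
    level n q (j - 1) = level n q j ↔ j ∉ breaks n q := by
  obtain ⟨j, rfl⟩ := Nat.exists_eq_succ_of_ne_zero hj
  exact level_succ_eq_iff

theorem blockFn_simpleLow_eq_iff {q : List ℕ} (j : Fin n) :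
    blockFn n q (simpleLow j) = blockFn n q (pos j) ↔
      if (j : ℕ) = 0 then 0 ∉ breaks n q ∧ 1 ∉ breaks n q else (j : ℕ) ∉ breaks n q := by
  by_cases hj : (j : ℕ) = 0
  · rw [if_pos hj, simpleLow_of_eq_zero hn hj, blockFn_rev, blockFn_pos, blockFn_pos, hj,
      ← level_zero_eq_iff, ← level_pred_eq_iff one_ne_zero]
    simp only [Nat.sub_self]
    omega
  · rw [if_neg hj, simpleLow_of_ne_zero hj, blockFn_pos, blockFn_pos, Nat.cast_inj]
    exact level_pred_eq_iff hj

omit hn in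
theorem monoOffRev_blockFn (q : List ℕ) : MonoOffRev (blockFn n q) :=
  fun _ _ h _ => blockFn_monotone n q h.le

omit hn in
theorem JofC_of_sum_eq {q : List ℕ} (hq : q.sum = n) (h0 : 0 < n) :
    {0} ∪ {s | ∃ j, 1 ≤ j ∧ j < q.length ∧ s = psum q j} = breaks n q := by
  have hlen : 0 < q.length := by
    rw [List.length_pos_iff]
    rintro rfl
    simp at hq
    omega
  ext s
  simp only [breaks, Set.mem_union, Set.mem_singleton_iff, Set.mem_ofPred_eq, hq, Nat.sub_self,
    zero_add]
  constructor
  · rintro (rfl | ⟨j, -, hj, rfl⟩)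
    · exact ⟨0, hlen, rfl⟩
    · exact ⟨j, hj, rfl⟩
  · rintro ⟨j, hj, rfl⟩
    rcases Nat.eq_zero_or_pos j with rfl | h
    · exact Or.inl rfl
    · exact Or.inr ⟨j, h, hj, rfl⟩

theorem XX_breaks {q : List ℕ} (h : 0 ∈ breaks n q ∨ 1 ∉ breaks n q) :
    XX n (Set.Iio n \ breaks n q) = offRevSum (ofPerm n) q 1 := by
  rw [XX_eq_sum hn (blockFn_rev q) (monoOffRev_blockFn q) Set.sdiff_subset, offRevSum, offRevPerms]
  intro j
  rw [blockFn_simpleLow_eq_iff hn, Set.mem_sdiff, Set.mem_Iio]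
  have := j.2
  split_ifs with hj
  · rw [hj]
    have h0 : 0 < n := by omega
    tauto
  · tauto

theorem B_lt {q : List ℕ} (hq : q.sum + 2 ≤ n) : B n .lt q = offRevSum (ofPerm n) q 1 := by
  refine XX_breaks hn (Or.inr ?_)
  rintro ⟨j, -, h⟩
  omega

theorem B_one {q : List ℕ} (hq : q.sum = n) : B n .one q = offRevSum (ofPerm n) q 1 := by
  rw [B, JofC, JofC_of_sum_eq hq (by omega)]
  refine XX_breaks hn (Or.inl ?_)
  rw [← JofC_of_sum_eq hq (by omega)]
  exact Or.inl rfl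

theorem B_reg {q : List ℕ} (hq : q.sum = n) : B n .reg q = offRevSum (ofPerm n) q 1 :=
  B_one hn hq

theorem B_plainKind {q : List ℕ} (hq : q.sum = n ∨ q.sum + 2 ≤ n) :
    B n (plainKind n q) q = offRevSum (ofPerm n) q 1 := by
  rw [plainKind]
  split_ifs
  · exact B_lt hn (by omega)
  · exact B_one hn (by omega)
  · exact B_reg hn (by omega)

theorem B_prime {q : List ℕ} (hq : q.sum = n) (h2 : 2 ≤ q.headD 0) (hn0 : 0 < n) :
    B n .prime q = offRevSum (ofPerm n) q (-1) * ofPerm n (centralSwap hn0) := by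
  have hps : ∀ i, 1 ≤ i → 2 ≤ psum q i := by
    intro i hi
    refine le_trans ?_ (psum_mono q hi)
    rcases q with _ | ⟨a, q⟩
    · simp at h2
    · simpa [psum] using h2
  have h1b : 1 ∉ breaks n q := by
    rintro ⟨i, -, hi⟩
    rcases Nat.eq_zero_or_pos i with rfl | h
    · rw [psum_zero] at hi; omega
    · have := hps i h; omega
  have h0b : 0 ∈ breaks n q := by
    rw [← JofC_of_sum_eq hq hn0]; exact Or.inl rfl
  have hσ := centralSwap_mem hn0
  have hodd : ∀ x, (blockFn n q ∘ centralSwap hn0) x.rev = -(blockFn n q ∘ centralSwap hn0) x := by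
    intro x
    simp only [Function.comp, hσ x, blockFn_rev]
  have hmono : MonoOffRev (blockFn n q ∘ centralSwap hn0) := fun x y h h' =>
    blockFn_monotone n q (centralSwap_lt hn0 h h').le
  have hσ2 : ∀ x : Fin (n + n), (x : ℕ) ≠ n → (x : ℕ) ≠ n - 1 → centralSwap hn0 x = x := by
    intro x h1 h2
    rw [Fin.ext_iff, centralSwap_apply, if_neg h1, if_neg h2]
  have hσp : ∀ h, centralSwap hn0 (pos ⟨0, h⟩) = (pos ⟨0, hn0⟩).rev := fun h =>
    Equiv.swap_apply_left _ _
  have hl1 : level n q 0 = level n q 1 := level_succ_eq_iff.2 h1b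
  have hl0 : level n q 0 ≠ 0 := fun h => level_zero_eq_iff.1 h h0b
  rw [B, XX_eq_sum hn hodd hmono Set.sdiff_subset, offRevSum, Finset.sum_mul]
  · refine Finset.sum_nbij' (· * centralSwap hn0) (· * centralSwap hn0) ?_ ?_ ?_ ?_ ?_
    · intro w hw
      simp only [Finset.mem_filter, Finset.mem_univ, true_and] at hw
      rw [mem_offRevPerms]
      refine ⟨(signedPerms n).mul_mem hw.1 hσ, fun x y hxy hne hfe => ?_⟩
      refine hw.2 _ _ (centralSwap_lt hn0 hxy hne) (ne_rev_apply hσ hne) ?_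
      simp only [Function.comp, ← Equiv.Perm.mul_apply, centralSwap_mul_self]
      exact hfe
    · intro w hw
      rw [mem_offRevPerms] at hw
      simp only [Finset.mem_filter, Finset.mem_univ, true_and]
      exact ⟨(signedPerms n).mul_mem hw.1 hσ, fun x y hxy hne hfe =>
        hw.2 _ _ (centralSwap_lt hn0 hxy hne) (ne_rev_apply hσ hne) hfe⟩
    · simp
    · simp
    · intro w _
      simp only [Equiv.Perm.sign_mul, sign_centralSwap, mul_neg_one, neg_inj, ite_mul, zero_mul,
        ← map_mul, mul_centralSwap_mul_centralSwap]
  · intro j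
    have hj := j.2
    rw [JofC, Set.mem_sdiff, Set.mem_Iio, Set.mem_union, Set.mem_singleton_iff, Set.mem_ofPred_eq]
    simp only [Function.comp]
    by_cases hj0 : (j : ℕ) = 0
    · have hjp : j = ⟨0, hn0⟩ := Fin.ext hj0
      have hlow : centralSwap hn0 (pos ⟨1, hn⟩).rev = (pos ⟨1, hn⟩).rev := by
        rw [hσ, hσ2] <;> simp only [pos_val] <;> omega
      rw [simpleLow_of_eq_zero hn hj0, hlow, hjp, hσp, blockFn_rev, blockFn_rev, blockFn_pos,
        blockFn_pos]
      simp only [hl1, iff_true]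
      refine ⟨hn0, ?_⟩
      rintro (h | ⟨i, hi, -, h⟩)
      · omega
      · have := hps i hi; omega
    · rw [simpleLow_of_ne_zero hj0]
      by_cases hj1 : (j : ℕ) = 1
      · have hjp : j = ⟨1, hn⟩ := Fin.ext hj1
        subst hjp
        have hhi : centralSwap hn0 (pos ⟨1, hn⟩) = pos ⟨1, hn⟩ := by
          rw [hσ2] <;> simp only [pos_val] <;> omega
        simp only [Nat.sub_self]
        rw [hσp, hhi, blockFn_rev, blockFn_pos, blockFn_pos]
        constructor
        · rintro ⟨-, h⟩
          exact absurd (Or.inl trivial) h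
        · intro h
          simp only at h
          omega
      · rw [hσ2, hσ2, blockFn_pos, blockFn_pos, Nat.cast_inj, level_pred_eq_iff hj0,
          ← JofC_of_sum_eq hq hn0]
        · simp only [hj, hj0, hj1, true_and, Set.mem_union, Set.mem_singleton_iff, false_or,
            Set.mem_ofPred_eq]
        all_goals simp only [pos_val]
        all_goals omega

end

/-! ### The multiplication rule -/

theorem units_neg_one_pow_eq_one_iff {m : ℕ} : (-1 : ℤˣ) ^ m = 1 ↔ ¬ Odd m := by
  rcases Nat.even_or_odd m with h | h
  · simp [h.neg_one_pow, h]
  · simp only [h.neg_one_pow, h, not_true_eq_false, iff_false]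
    decide

theorem units_neg_one_pow_eq_neg_one_iff {m : ℕ} : (-1 : ℤˣ) ^ m = -1 ↔ Odd m := by
  rcases Nat.even_or_odd m with h | h
  · rw [h.neg_one_pow]
    simp only [Nat.not_odd_iff_even.2 h, iff_false]
    decide
  · simp [h.neg_one_pow, h]

section

variable {n : ℕ} {p q : List ℕ} {t : FT}

theorem add_sum_eq_of_mem_marginTemplates (ht : t ∈ marginTemplates n p q) :
    t.z 0 0 + ∑ i ∈ Finset.Icc 1 t.u, t.z i 0 = n - p.sum ∧
      t.z 0 0 + ∑ j ∈ Finset.Icc 1 t.v, t.z 0 j = n - q.sum := by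
  obtain ⟨-, -, -, h1, -, h2⟩ := ht
  rw [sum_Icc_zero] at h1 h2
  exact ⟨h1, h2⟩

theorem borderSum_eq_zero_iff (ht : t ∈ marginTemplates n p q) (hp : p.sum ≤ n) (hq : q.sum ≤ n) :
    borderSum t = 0 ↔ p.sum = n ∧ q.sum = n := by
  have := add_sum_eq_of_mem_marginTemplates ht
  rw [borderSum]
  omega

theorem corner_eq_zero (ht : t ∈ marginTemplates n p q) (h : p.sum = n ∨ q.sum = n) :
    t.z 0 0 = 0 := by
  have := add_sum_eq_of_mem_marginTemplates ht
  omega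

theorem mem_Z_iff {kp kq : Kind} :
    t ∈ Z n kp p kq q ↔ t ∈ marginTemplates n p q ∧
      (borderSum t = 0 → (Odd (ySum t) ↔ oddCase kp kq)) := by
  simp only [Z, marginTemplates, Set.mem_ofPred_eq, and_assoc]

theorem Z_eq {kp kq : Kind} (hp : p.sum ≤ n) (hq : q.sum ≤ n) :
    Z n kp p kq q = ((marginFinset hp hq).filter fun t =>
      p.sum = n → q.sum = n → (Odd (ySum t) ↔ oddCase kp kq) : Finset FT) := by
  ext t
  simp only [Finset.coe_filter, Set.mem_ofPred_eq, mem_marginFinset, mem_Z_iff]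
  refine and_congr_right fun ht => ?_
  rw [borderSum_eq_zero_iff ht hp hq, and_imp]

theorem finsum_Z {M : Type*} [AddCommMonoid M] {kp kq : Kind} (hp : p.sum ≤ n) (hq : q.sum ≤ n)
    (F : FT → M) :
    ∑ᶠ t ∈ Z n kp p kq q, F t = ∑ t ∈ marginFinset hp hq,
      if p.sum = n → q.sum = n → (Odd (ySum t) ↔ oddCase kp kq) then F t else 0 := by
  rw [Z_eq hp hq, finsum_mem_coe_finset, Finset.sum_filter]

/-! ### The summands -/

variable {R : Type*} [Ring R] (θ : Equiv.Perm (Fin (n + n)) →* R)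

theorem sum_readWord (hq : q.sum ≤ n) (ht : t ∈ marginTemplates n p q) :
    (readWord t).sum = n ∧ t.z 0 0 ≤ 1 ∨ (readWord t).sum + 2 ≤ n := by
  have := sum_bodyWord_of_mem hq ht
  rw [readWord_eq]
  split_ifs <;> simp <;> omega

theorem offRevSum_readWord (hq : q.sum ≤ n) (ht : t ∈ marginTemplates n p q) (ε : ℤˣ) :
    offRevSum θ (readWord t) ε = offRevSum θ (bodyWord t) ε := by
  have := sum_bodyWord_of_mem hq ht
  rw [readWord_eq]
  split_ifs with h
  · rw [h] at this
    rw [List.singleton_append, offRevSum_of_sum_eq θ (by simp; omega), incrSum_cons_one θ this]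
  · rfl

theorem headD_readWord (hn : 2 ≤ n) (hq : q.sum ≤ n) (ht : t ∈ marginTemplates n p q)
    (h0 : t.z 0 0 = 0) : (readWord t).headD 0 = 1 ∨ 2 ≤ (readWord t).headD 0 := by
  have hs := sum_bodyWord_of_mem hq ht
  have hr : readWord t = bodyWord t := by rw [readWord_eq, if_neg (by omega)]; rfl
  rw [hr]
  rcases hb : bodyWord t with _ | ⟨a, l⟩
  · rw [hb, List.sum_nil] at hs; omega
  · have := pos_of_mem_bodyWord (t := t) (x := a) (by rw [hb]; simp)
    simp only [List.headD_cons]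
    omega

theorem offRevSum_bodyWord_mul_centralSwap (hn : 0 < n) (hq : q.sum ≤ n)
    (ht : t ∈ marginTemplates n p q) (h : t.z 0 0 ≠ 0 ∨ (readWord t).headD 0 = 1) (ε : ℤˣ) :
    offRevSum θ (bodyWord t) ε * θ (centralSwap hn) = offRevSum θ (bodyWord t) (-ε) := by
  have hs := sum_bodyWord_of_mem hq ht
  by_cases h0 : t.z 0 0 = 0
  · have hr : readWord t = bodyWord t := by rw [readWord_eq, if_neg (by omega)]; rfl
    have h1 := h.resolve_left (not_not.2 h0)
    rw [hr] at h1
    rcases hb : bodyWord t with _ | ⟨a, l⟩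
    · rw [hb] at h1; simp at h1
    · rw [hb, List.headD_cons] at h1
      subst h1
      rw [hb, h0, List.sum_cons] at hs
      rw [offRevSum_of_sum_eq θ (by rw [List.sum_cons]; omega),
        offRevSum_of_sum_eq θ (by rw [List.sum_cons]; omega), incrSum_cons_one θ (by omega),
        incrSum_cons_one θ (by omega), offRevSum_mul_centralSwap θ hn (by omega)]
  · exact offRevSum_mul_centralSwap θ hn (by omega) ε

end

section

variable {n : ℕ} (hn : 2 ≤ n) {p q : List ℕ} {t : FT} (hq : q.sum ≤ n)
  (ht : t ∈ marginTemplates n p q)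

/-- The unprimed summand attached to a template. -/
noncomputable def plainTerm (n : ℕ) (t : FT) : MonoidAlgebra ℚ (Equiv.Perm (Dom n)) :=
  offRevSum (ofPerm n) (bodyWord t) 1

/-- The primed summand attached to a template. -/
noncomputable def primeTerm (hn : 2 ≤ n) (t : FT) : MonoidAlgebra ℚ (Equiv.Perm (Dom n)) :=
  offRevSum (ofPerm n) (bodyWord t) (-1) * ofPerm n (centralSwap (zero_lt_two.trans_le hn))

include hq ht

include hn in
theorem B_readWord : B n (plainKind n (readWord t)) (readWord t) = plainTerm n t := by
  rw [B_plainKind hn, offRevSum_readWord _ hq ht, plainTerm]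
  have := sum_readWord hq ht
  tauto

theorem primeTerm_eq_plainTerm (h : t.z 0 0 ≠ 0 ∨ (readWord t).headD 0 = 1) :
    primeTerm hn t = plainTerm n t := by
  rw [primeTerm, offRevSum_bodyWord_mul_centralSwap _ _ hq ht h, neg_neg, plainTerm]

theorem B_prime_readWord (h0 : t.z 0 0 = 0) (h2 : 2 ≤ (readWord t).headD 0) :
    B n .prime (readWord t) = primeTerm hn t := by
  rw [B_prime hn _ h2 (zero_lt_two.trans_le hn), offRevSum_readWord _ hq ht, primeTerm]
  have := sum_bodyWord_of_mem hq ht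
  rw [readWord_eq, if_neg (by omega)]
  simpa [h0] using this

include hn in
theorem Btilde_of_plain_right {kp kq : Kind} (hk : kq = .one ∨ kq = .reg) :
    Btilde n kp kq t = plainTerm n t := by
  rcases hk with rfl | rfl <;> exact B_readWord hn hq ht

theorem Btilde_prime_right {kp : Kind} (h0 : t.z 0 0 = 0) :
    Btilde n kp .prime t = primeTerm hn t := by
  simp only [Btilde]
  rcases headD_readWord hn hq ht h0 with h | h
  · rw [if_pos h, B_readWord hn hq ht, primeTerm_eq_plainTerm hn hq ht (Or.inr h)]
  · rw [if_neg (by omega), B_prime_readWord hn hq ht h0 h]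

theorem Btilde_plain_lt {kp : Kind} (hk : kp = .one ∨ kp = .reg) (h0 : t.z 0 0 = 0) :
    Btilde n kp .lt t = if Odd (ySum t) then primeTerm hn t else plainTerm n t := by
  have hk1 : kp ≠ .lt := by rintro rfl; simp at hk
  have hk2 : kp ≠ .prime := by rintro rfl; simp at hk
  simp only [Btilde, hk, hk1, hk2, true_and, false_and, or_false, if_false]
  rcases headD_readWord hn hq ht h0 with h | h
  · rw [if_neg (by omega), B_readWord hn hq ht, primeTerm_eq_plainTerm hn hq ht (Or.inr h), ite_self]
  · simp only [h, true_and, B_prime_readWord hn hq ht h0 h, B_readWord hn hq ht]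

theorem Btilde_prime_lt (h0 : t.z 0 0 = 0) :
    Btilde n .prime .lt t = if Odd (ySum t) then plainTerm n t else primeTerm hn t := by
  simp only [Btilde, reduceCtorEq, or_self, false_and, true_and, false_or, if_false]
  rcases headD_readWord hn hq ht h0 with h | h
  · rw [if_neg (by omega), B_readWord hn hq ht, primeTerm_eq_plainTerm hn hq ht (Or.inr h), ite_self]
  · simp only [h, true_and, B_prime_readWord hn hq ht h0 h, B_readWord hn hq ht,
      ← Nat.not_odd_iff_even, ite_not]

theorem Btilde_lt_lt :
    Btilde n .lt .lt t = if t.z 0 0 = 0 then plainTerm n t + primeTerm hn t else plainTerm n t := by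
  simp only [Btilde, reduceCtorEq, or_self, false_and, true_and, and_false, if_false]
  split_ifs with h0 h
  · rw [B_readWord hn hq ht, primeTerm_eq_plainTerm hn hq ht (Or.inr h), two_smul]
  · rw [B_readWord hn hq ht,
      B_prime_readWord hn hq ht h0 ((headD_readWord hn hq ht h0).resolve_left h)]
  · exact B_readWord hn hq ht

end

section

variable {n : ℕ} {p q : List ℕ} {R : Type*} [Ring R] (θ : Equiv.Perm (Fin (n + n)) →* R)

theorem incrSum_bodyWord {t : FT} (hq : q.sum ≤ n) (ht : t ∈ marginTemplates n p q)
    (h0 : t.z 0 0 = 0) (ε : ℤˣ) : incrSum θ (bodyWord t) ε = offRevSum θ (bodyWord t) ε := by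
  have := sum_bodyWord_of_mem hq ht
  rw [offRevSum_of_sum_eq]
  omega

theorem offRevSum_mul_incrSum (hp : p.sum = n) (hq : q.sum ≤ n) (ε δ : ℤˣ) :
    offRevSum θ p ε * incrSum θ q δ = ∑ t ∈ marginFinset hp.le hq,
      if (-1) ^ ySum t = δ then offRevSum θ (bodyWord t) (ε * δ) else 0 := by
  rw [offRevSum_of_sum_eq θ hp, incrSum_mul_incrSum θ hp hq]
  refine Finset.sum_congr rfl fun t ht => ?_
  rw [mem_marginFinset] at ht
  rw [incrSum_bodyWord θ hq ht (corner_eq_zero ht (Or.inl hp))]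

theorem offRevSum_mul_offRevSum_of_lt (hn : 0 < n) (hp : p.sum < n) (q : List ℕ) (ε : ℤˣ) :
    offRevSum θ p 1 * offRevSum θ q ε =
      incrSum θ p 1 * offRevSum θ q ε + incrSum θ p (-1) * offRevSum θ q (-ε) := by
  rw [offRevSum_of_sum_lt θ hn hp, add_mul, mul_assoc, centralSwap_mul_offRevSum]

theorem offRevSum_mul_offRevSum_of_lt_of_eq (hn : 0 < n) (hp : p.sum < n) (hq : q.sum = n)
    (ε : ℤˣ) : offRevSum θ p 1 * offRevSum θ q ε =
      ∑ t ∈ marginFinset hp.le hq.le, offRevSum θ (bodyWord t) ε := by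
  have h : offRevSum θ p 1 * offRevSum θ q ε =
      incrSum θ p ε * incrSum θ q 1 + incrSum θ p (-ε) * incrSum θ q (-1) := by
    rw [offRevSum_mul_offRevSum_of_lt θ hn hp, offRevSum_of_sum_eq θ hq, offRevSum_of_sum_eq θ hq]
    rcases Int.units_eq_one_or ε with rfl | rfl
    · rfl
    · rw [neg_neg, add_comm]
  rw [h, incrSum_mul_incrSum_add θ hp.le hq.le]
  refine Finset.sum_congr rfl fun t ht => ?_
  rw [mem_marginFinset] at ht
  rw [incrSum_bodyWord θ hq.le ht (corner_eq_zero ht (Or.inr hq))]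

theorem offRevSum_mul_offRevSum_of_lt_of_lt (hn : 0 < n) (hp : p.sum < n) (hq : q.sum < n) :
    offRevSum θ p 1 * offRevSum θ q 1 = ∑ t ∈ marginFinset hp.le hq.le,
      (incrSum θ (bodyWord t) 1 + incrSum θ (bodyWord t) (-1) * θ (centralSwap hn)) := by
  rw [Finset.sum_add_distrib, ← Finset.sum_mul, ← incrSum_mul_incrSum_add θ hp.le hq.le,
    ← incrSum_mul_incrSum_add θ hp.le hq.le, offRevSum_mul_offRevSum_of_lt θ hn hp,
    offRevSum_of_sum_lt θ hn hq, offRevSum_of_sum_lt θ hn hq, neg_neg]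
  noncomm_ring

end

/-! ### Products of basis elements, by families -/

section

variable {n : ℕ} (hn : 2 ≤ n) {p q : List ℕ}

theorem plain_mul_plain (hp : p.sum = n) (hq : q.sum = n) :
    offRevSum (ofPerm n) p 1 * offRevSum (ofPerm n) q 1 = ∑ t ∈ marginFinset hp.le hq.le,
      if Odd (ySum t) then 0 else plainTerm n t := by
  rw [offRevSum_of_sum_eq _ hq, offRevSum_mul_incrSum _ hp hq.le]
  simp only [units_neg_one_pow_eq_one_iff, ite_not, mul_one, plainTerm]

theorem plain_mul_plain_of_lt (hp : p.sum = n) (hq : q.sum < n) :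
    offRevSum (ofPerm n) p 1 * offRevSum (ofPerm n) q 1 = ∑ t ∈ marginFinset hp.le hq.le,
      if Odd (ySum t) then primeTerm hn t else plainTerm n t := by
  rw [offRevSum_of_sum_lt _ (zero_lt_two.trans_le hn) hq, mul_add, ← mul_assoc,
    offRevSum_mul_incrSum _ hp hq.le, offRevSum_mul_incrSum _ hp hq.le, Finset.sum_mul,
    ← Finset.sum_add_distrib]
  refine Finset.sum_congr rfl fun t _ => ?_
  simp only [units_neg_one_pow_eq_one_iff, units_neg_one_pow_eq_neg_one_iff, plainTerm, primeTerm,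
    one_mul]
  split_ifs <;> simp

theorem plain_mul_prime (hp : p.sum = n) (hq : q.sum = n) :
    offRevSum (ofPerm n) p 1 * (offRevSum (ofPerm n) q (-1) *
      ofPerm n (centralSwap (zero_lt_two.trans_le hn))) = ∑ t ∈ marginFinset hp.le hq.le,
      if Odd (ySum t) then primeTerm hn t else 0 := by
  rw [offRevSum_of_sum_eq _ hq, ← mul_assoc, offRevSum_mul_incrSum _ hp hq.le, Finset.sum_mul]
  simp only [units_neg_one_pow_eq_neg_one_iff, one_mul, primeTerm, ite_mul, zero_mul]

theorem prime_mul_plain (hp : p.sum = n) (hq : q.sum = n) (h0 : 0 < n) :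
    offRevSum (ofPerm n) p (-1) * ofPerm n (centralSwap h0) * offRevSum (ofPerm n) q 1 =
      ∑ t ∈ marginFinset hp.le hq.le, if Odd (ySum t) then plainTerm n t else 0 := by
  rw [mul_assoc, centralSwap_mul_offRevSum, offRevSum_of_sum_eq _ hq,
    offRevSum_mul_incrSum _ hp hq.le]
  simp only [units_neg_one_pow_eq_neg_one_iff, neg_mul_neg, one_mul, plainTerm]

theorem prime_mul_plain_of_lt (hp : p.sum = n) (hq : q.sum < n) :
    offRevSum (ofPerm n) p (-1) * ofPerm n (centralSwap (zero_lt_two.trans_le hn)) *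
      offRevSum (ofPerm n) q 1 = ∑ t ∈ marginFinset hp.le hq.le,
        if Odd (ySum t) then plainTerm n t else primeTerm hn t := by
  rw [mul_assoc, centralSwap_mul_offRevSum, offRevSum_of_sum_lt _ (zero_lt_two.trans_le hn) hq,
    mul_add, ← mul_assoc, offRevSum_mul_incrSum _ hp hq.le, offRevSum_mul_incrSum _ hp hq.le,
    Finset.sum_mul, ← Finset.sum_add_distrib]
  refine Finset.sum_congr rfl fun t _ => ?_
  simp only [units_neg_one_pow_eq_one_iff, units_neg_one_pow_eq_neg_one_iff, plainTerm, primeTerm,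
    neg_neg, neg_mul_neg, mul_one]
  split_ifs <;> simp

theorem prime_mul_prime (hp : p.sum = n) (hq : q.sum = n) :
    offRevSum (ofPerm n) p (-1) * ofPerm n (centralSwap (zero_lt_two.trans_le hn)) *
      (offRevSum (ofPerm n) q (-1) * ofPerm n (centralSwap (zero_lt_two.trans_le hn))) =
      ∑ t ∈ marginFinset hp.le hq.le, if Odd (ySum t) then 0 else primeTerm hn t := by
  rw [← mul_assoc, mul_assoc (offRevSum _ p _), centralSwap_mul_offRevSum, neg_neg,
    offRevSum_of_sum_eq _ hq, offRevSum_mul_incrSum _ hp hq.le, Finset.sum_mul]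
  simp only [units_neg_one_pow_eq_one_iff, mul_one, primeTerm, ite_mul, zero_mul, ite_not]

theorem lt_mul_prime (hp : p.sum < n) (hq : q.sum = n) :
    offRevSum (ofPerm n) p 1 * (offRevSum (ofPerm n) q (-1) *
      ofPerm n (centralSwap (zero_lt_two.trans_le hn))) =
      ∑ t ∈ marginFinset hp.le hq.le, primeTerm hn t := by
  rw [← mul_assoc, offRevSum_mul_offRevSum_of_lt_of_eq _ (zero_lt_two.trans_le hn) hp hq,
    Finset.sum_mul]
  rfl

theorem lt_mul_lt (hp : p.sum < n) (hq : q.sum < n) :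
    offRevSum (ofPerm n) p 1 * offRevSum (ofPerm n) q 1 = ∑ t ∈ marginFinset hp.le hq.le,
      if t.z 0 0 = 0 then plainTerm n t + primeTerm hn t else plainTerm n t := by
  rw [offRevSum_mul_offRevSum_of_lt_of_lt _ (zero_lt_two.trans_le hn) hp hq]
  refine Finset.sum_congr rfl fun t ht => ?_
  rw [mem_marginFinset] at ht
  split_ifs with h0
  · rw [incrSum_bodyWord _ hq.le ht h0, incrSum_bodyWord _ hq.le ht h0]
    rfl
  · have := sum_bodyWord_of_mem hq.le ht
    rw [plainTerm, offRevSum_of_sum_lt _ (zero_lt_two.trans_le hn) (by omega)]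

theorem sum_le_of_memC {k : Kind} (hq : memC n k q) : q.sum ≤ n := by
  cases k <;> simp only [memC] at hq <;> omega

end

/-- **The multiplication rule for the descent algebra of type `D`.**
For `p, q ∈ C(n)`, `B_p B_q = Σ_{t ∈ Z(p,q)} B̃_{r(t)}`. -/
theorem descentD_multiplication_rule (n : ℕ) (hn : 2 ≤ n) (kp kq : Kind)
    (p q : List ℕ) (hp : memC n kp p) (hq : memC n kq q) :
    (Z n kp p kq q).Finite ∧
      B n kp p * B n kq q = ∑ᶠ t ∈ Z n kp p kq q, Btilde n kp kq t := by
  have hp' := sum_le_of_memC hp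
  have hq' := sum_le_of_memC hq
  refine ⟨?_, ?_⟩
  · rw [Z_eq hp' hq']
    exact Finset.finite_toSet _
  have hn0 : 0 < n := zero_lt_two.trans_le hn
  have hplain : ∀ (k : Kind) (r : List ℕ), memC n k r → k = .one ∨ k = .reg →
      B n k r = offRevSum (ofPerm n) r 1 ∧ r.sum = n := by
    rintro k r hr (rfl | rfl)
    · exact ⟨B_one hn hr.2.1, hr.2.1⟩
    · exact ⟨B_reg hn hr.2.1, hr.2.1⟩
  have hprime : ∀ r : List ℕ, memC n .prime r →
      B n .prime r = offRevSum (ofPerm n) r (-1) * ofPerm n (centralSwap hn0) ∧ r.sum = n :=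
    fun r hr => ⟨B_prime hn hr.2.1 hr.2.2 hn0, hr.2.1⟩
  have hlt : ∀ r : List ℕ, memC n .lt r → B n .lt r = offRevSum (ofPerm n) r 1 ∧ r.sum < n :=
    fun r hr => ⟨B_lt hn hr.2, by have := hr.2; omega⟩
  have hkind : ∀ k : Kind, k = .lt ∨ k = .prime ∨ (k = .one ∨ k = .reg) := by
    rintro (_ | _ | _ | _) <;> simp
  rw [finsum_Z hp' hq']
  rcases hkind kp with rfl | rfl | hkp
  · obtain ⟨hBp, hps⟩ := hlt p hp
    simp only [hps.ne, false_imp_iff, if_true]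
    rcases hkind kq with rfl | rfl | hkq
    · obtain ⟨hBq, hqs⟩ := hlt q hq
      rw [hBp, hBq, lt_mul_lt hn hps hqs]
      refine Finset.sum_congr rfl fun t ht => ?_
      rw [Btilde_lt_lt hn hq' (mem_marginFinset.1 ht)]
    · obtain ⟨hBq, hqs⟩ := hprime q hq
      rw [hBp, hBq, lt_mul_prime hn hps hqs]
      refine Finset.sum_congr rfl fun t ht => ?_
      have ht := mem_marginFinset.1 ht
      rw [Btilde_prime_right hn hq' ht (corner_eq_zero ht (Or.inr hqs))]
    · obtain ⟨hBq, hqs⟩ := hplain kq q hq hkq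
      rw [hBp, hBq, offRevSum_mul_offRevSum_of_lt_of_eq _ hn0 hps hqs]
      refine Finset.sum_congr rfl fun t ht => ?_
      rw [Btilde_of_plain_right hn hq' (mem_marginFinset.1 ht) hkq, plainTerm]
  · obtain ⟨hBp, hps⟩ := hprime p hp
    rcases hkind kq with rfl | rfl | hkq
    · obtain ⟨hBq, hqs⟩ := hlt q hq
      rw [hBp, hBq, prime_mul_plain_of_lt hn hps hqs]
      refine Finset.sum_congr rfl fun t ht => ?_
      have ht := mem_marginFinset.1 ht
      rw [Btilde_prime_lt hn hq' ht (corner_eq_zero ht (Or.inl hps))]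
      simp only [hqs.ne, false_imp_iff, imp_true_iff, if_true]
    · obtain ⟨hBq, hqs⟩ := hprime q hq
      rw [hBp, hBq, prime_mul_prime hn hps hqs]
      refine Finset.sum_congr rfl fun t ht => ?_
      have ht := mem_marginFinset.1 ht
      rw [Btilde_prime_right hn hq' ht (corner_eq_zero ht (Or.inl hps))]
      simp [hps, hqs, oddCase, -Nat.not_odd_iff_even]
    · obtain ⟨hBq, hqs⟩ := hplain kq q hq hkq
      rw [hBp, hBq, prime_mul_plain hps hqs]
      refine Finset.sum_congr rfl fun t ht => ?_
      rw [Btilde_of_plain_right hn hq' (mem_marginFinset.1 ht) hkq]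
      simp [hps, hqs, oddCase, hkq]
  · obtain ⟨hBp, hps⟩ := hplain kp p hp hkp
    have hkp' : kp ≠ .prime := by rintro rfl; simp at hkp
    rcases hkind kq with rfl | rfl | hkq
    · obtain ⟨hBq, hqs⟩ := hlt q hq
      rw [hBp, hBq, plain_mul_plain_of_lt hn hps hqs]
      refine Finset.sum_congr rfl fun t ht => ?_
      have ht := mem_marginFinset.1 ht
      rw [Btilde_plain_lt hn hq' ht hkp (corner_eq_zero ht (Or.inl hps))]
      simp only [hqs.ne, false_imp_iff, imp_true_iff, if_true]
    · obtain ⟨hBq, hqs⟩ := hprime q hq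
      rw [hBp, hBq, plain_mul_prime hn hps hqs]
      refine Finset.sum_congr rfl fun t ht => ?_
      have ht := mem_marginFinset.1 ht
      rw [Btilde_prime_right hn hq' ht (corner_eq_zero ht (Or.inl hps))]
      simp [hps, hqs, oddCase, hkp]
    · obtain ⟨hBq, hqs⟩ := hplain kq q hq hkq
      have hkq' : kq ≠ .prime := by rintro rfl; simp at hkq
      rw [hBp, hBq, plain_mul_plain hps hqs]
      refine Finset.sum_congr rfl fun t ht => ?_
      rw [Btilde_of_plain_right hn hq' (mem_marginFinset.1 ht) hkq]
      simp [hps, hqs, oddCase, hkp', hkq', -Nat.not_odd_iff_even]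

end DescentD
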